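/- Let A be plus-one generated with POexp(A) = (d_1,…,d_ℓ) and level d (so d_1 = 1, the degree of the Euler derivation). Then b_1(A) = |A| = Σ_{i=2}^ℓ d_i and b_2(A) = Σ_{2 ≤ i < j ≤ ℓ} d_i d_j + d. -/

import Mathlib

open MvPolynomial

noncomputable section

attribute [local instance] Classical.propDecidable

namespace ArrPOG

variable (K : Type) [Field K] (ℓ : ℕ)

/-- A polynomial vector field on `K^ℓ`: `θ = Σ θᵢ ∂/∂xᵢ`, identified with its
coefficient vector `(θ₁,…,θ_ℓ)` in `S = K[x₁,…,x_ℓ]`. -/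
abbrev Deriv : Type := Fin ℓ → MvPolynomial (Fin ℓ) K

variable {K ℓ}

/-- The linear polynomial `α_H ∈ S` associated to a linear form `φ ∈ V*`. -/
def linPoly (φ : Module.Dual K (Fin ℓ → K)) : MvPolynomial (Fin ℓ) K :=
  ∑ i, MvPolynomial.C (φ (Pi.single i 1)) * MvPolynomial.X i

/-- `θ(α)` for a derivation `θ` and the linear form `α` given by `φ ∈ V*`. -/
def applyLin (θ : Deriv K ℓ) (φ : Module.Dual K (Fin ℓ → K)) : MvPolynomial (Fin ℓ) K :=
  ∑ i, MvPolynomial.C (φ (Pi.single i 1)) * θ i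

/-- An arrangement: a finite set of hyperplanes (kernels of nonzero linear forms). -/
def IsArrangement (A : Finset (Submodule K (Fin ℓ → K))) : Prop :=
  ∀ H ∈ A, ∃ φ : Module.Dual K (Fin ℓ → K), φ ≠ 0 ∧ LinearMap.ker φ = H

/-- Essential: the common intersection of all members is `0`. -/
def Essential (A : Finset (Submodule K (Fin ℓ → K))) : Prop :=
  A.inf id = ⊥

/-- Membership in the logarithmic derivation module `D(A)`:
`θ(α_H) ∈ S·α_H` for every `H ∈ A`. -/
def InD (A : Finset (Submodule K (Fin ℓ → K))) (θ : Deriv K ℓ) : Prop :=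
  ∀ H ∈ A, ∀ φ : Module.Dual K (Fin ℓ → K), LinearMap.ker φ = H → linPoly φ ∣ applyLin θ φ

/-- A derivation is homogeneous of degree `n` if all its coefficients are. -/
def HomogDeriv (θ : Deriv K ℓ) (n : ℕ) : Prop := ∀ i, (θ i).IsHomogeneous n

/-- `θ₁,…,θₙ` generate `D(A)` as an `S`-module. -/
def GeneratesD {n : ℕ} (A : Finset (Submodule K (Fin ℓ → K))) (θ : Fin n → Deriv K ℓ) : Prop :=
  (∀ i, InD A (θ i)) ∧
    ∀ η, InD A η → ∃ c : Fin n → MvPolynomial (Fin ℓ) K, η = ∑ i, c i • θ i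

/-- `S`-linear independence of a family of derivations. -/
def IndepD {n : ℕ} (θ : Fin n → Deriv K ℓ) : Prop :=
  ∀ c : Fin n → MvPolynomial (Fin ℓ) K, (∑ i, c i • θ i) = 0 → ∀ i, c i = 0

/-- `A` is free with exponents `e`: `D(A)` has a homogeneous basis of degrees `e i`. -/
def IsFreeExp (A : Finset (Submodule K (Fin ℓ → K))) (e : Fin ℓ → ℕ) : Prop :=
  ∃ θ : Fin ℓ → Deriv K ℓ, (∀ i, HomogDeriv (θ i) (e i)) ∧ GeneratesD A θ ∧ IndepD θ

/-- `A` is free. -/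
def IsFree (A : Finset (Submodule K (Fin ℓ → K))) : Prop := ∃ e, IsFreeExp A e

/-- `A` is plus-one generated with exponents `e`, level `lev`, realized by the minimal
homogeneous generators `θ₁,…,θ_ℓ, φ` whose unique syzygy is `Σ fᵢ•θᵢ + α•φ = 0`:
this encodes the minimal free resolution
`0 → S[-lev-1] → S[-lev] ⊕ (⊕ S[-eᵢ]) → D(A) → 0`. -/
def IsPOGWith (A : Finset (Submodule K (Fin ℓ → K))) (e : Fin ℓ → ℕ) (lev : ℕ)
    (θ : Fin ℓ → Deriv K ℓ) (φ : Deriv K ℓ)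
    (f : Fin ℓ → MvPolynomial (Fin ℓ) K) (α : MvPolynomial (Fin ℓ) K) : Prop :=
  (∀ i, InD A (θ i)) ∧ InD A φ ∧
  (∀ i, HomogDeriv (θ i) (e i)) ∧ HomogDeriv φ lev ∧
  (∀ η, InD A η → ∃ (c : Fin ℓ → MvPolynomial (Fin ℓ) K) (g : MvPolynomial (Fin ℓ) K),
      η = (∑ i, c i • θ i) + g • φ) ∧
  α.IsHomogeneous 1 ∧
  (∀ i, (f i).IsHomogeneous (lev + 1 - e i)) ∧
  (∀ i, MvPolynomial.constantCoeff (f i) = 0) ∧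
  ((∑ i, f i • θ i) + α • φ = 0) ∧
  (¬ (α = 0 ∧ ∀ i, f i = 0)) ∧
  (∀ (g : Fin ℓ → MvPolynomial (Fin ℓ) K) (h : MvPolynomial (Fin ℓ) K),
      ((∑ i, g i • θ i) + h • φ = 0) →
      ∃ q : MvPolynomial (Fin ℓ) K, (∀ i, g i = q * f i) ∧ h = q * α)

/-- Plus-one generated with exponents `e` and level `lev`. -/
def IsPOG (A : Finset (Submodule K (Fin ℓ → K))) (e : Fin ℓ → ℕ) (lev : ℕ) : Prop :=
  ∃ θ φ f α, IsPOGWith A e lev θ φ f α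

/-- Strictly plus-one generated: the level coefficient `α` is nonzero. -/
def IsSPOG (A : Finset (Submodule K (Fin ℓ → K))) (e : Fin ℓ → ℕ) (lev : ℕ) : Prop :=
  ∃ θ φ f α, IsPOGWith A e lev θ φ f α ∧ α ≠ 0

/-- The restriction `A^H = {L ⊓ H | L ∈ A \ {H}}`. -/
def restrict (A : Finset (Submodule K (Fin ℓ → K))) (H : Submodule K (Fin ℓ → K)) :
    Finset (Submodule K (Fin ℓ → K)) :=
  (A.erase H).image (fun L => L ⊓ H)

/-- The localization `A_X = {L ∈ A | X ⊆ L}`. -/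
def localize (A : Finset (Submodule K (Fin ℓ → K))) (X : Submodule K (Fin ℓ → K)) :
    Finset (Submodule K (Fin ℓ → K)) :=
  A.filter (fun L => X ≤ L)

/-- The intersection lattice of `A`, inside the ambient space `T`. -/
def latticeOf (T : Submodule K (Fin ℓ → K)) (A : Finset (Submodule K (Fin ℓ → K))) :
    Finset (Submodule K (Fin ℓ → K)) :=
  A.powerset.image (fun B => T ⊓ B.inf id)

/-- The Möbius function of the poset `L` (intersection lattice with top `T`). -/
def mob (T : Submodule K (Fin ℓ → K)) (L : Finset (Submodule K (Fin ℓ → K)))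
    (X : Submodule K (Fin ℓ → K)) : ℤ :=
  if X = T then 1
  else - ∑ Y ∈ (L.filter fun Z => X < Z).attach, mob T L Y.1
termination_by (L.filter fun Z => X < Z).card
decreasing_by
  obtain ⟨Y, hY⟩ := Y
  simp only [Finset.mem_filter] at hY
  apply Finset.card_lt_card
  rw [Finset.ssubset_def]
  constructor
  · intro Z hZ
    simp only [Finset.mem_filter] at hZ ⊢
    exact ⟨hZ.1, lt_trans hY.2 hZ.2⟩
  · intro hsub
    have h2 := hsub (Finset.mem_filter.mpr ⟨hY.1, hY.2⟩)
    simp only [Finset.mem_filter] at h2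
    exact lt_irrefl Y h2.2

/-- The characteristic polynomial `χ(A;t) = Σ_{X ∈ L(A)} μ(X) t^{dim X}`
of an arrangement inside the ambient space `T`. -/
def charPoly (T : Submodule K (Fin ℓ → K)) (A : Finset (Submodule K (Fin ℓ → K))) :
    Polynomial ℤ :=
  ∑ X ∈ latticeOf T A,
    Polynomial.C (mob T (latticeOf T A) X) * Polynomial.X ^ (Module.finrank K X)

/-- The Betti number `b_i(A)`: `χ(A;t) = Σ (-1)^i b_i(A) t^{ℓ-i}`. -/
def bNum (A : Finset (Submodule K (Fin ℓ → K))) (i : ℕ) : ℤ :=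
  (-1) ^ i * (charPoly (⊤ : Submodule K (Fin ℓ → K)) A).coeff (ℓ - i)

/-- Evaluation of the Poincaré polynomial `π(A;t) = Σ μ(X) (-t)^{codim X}` at `t : ℚ`. -/
def poincareEval (A : Finset (Submodule K (Fin ℓ → K))) (t : ℚ) : ℚ :=
  ∑ X ∈ latticeOf ⊤ A,
    (mob (⊤ : Submodule K (Fin ℓ → K)) (latticeOf ⊤ A) X : ℚ) *
      (-t) ^ (ℓ - Module.finrank K X)

/-- The Euler derivation `θ_E = Σ xᵢ ∂/∂xᵢ`. -/
def eulerD : Deriv K ℓ := fun i => MvPolynomial.X i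

/-- `A` is locally free: `A_X` is free for every `X ∈ L(A)` other than `∩_{H∈A} H`. -/
def LocallyFree (A : Finset (Submodule K (Fin ℓ → K))) : Prop :=
  ∀ X ∈ latticeOf ⊤ A, X ≠ A.inf id → IsFree (localize A X)

/-- Transport a finite set of subspaces contained in `T` to `K^m` along a linear
isomorphism `T ≃ K^m`. -/
def transport {m : ℕ} (T : Submodule K (Fin ℓ → K)) (eqv : T ≃ₗ[K] (Fin m → K))
    (A : Finset (Submodule K (Fin ℓ → K))) : Finset (Submodule K (Fin m → K)) :=
  A.image fun L => (L.comap T.subtype).map eqv.toLinearMap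

/-- An arrangement inside the subspace `T` is free with exponents `e`, i.e. it is free
after identifying `T` with a coordinate space. -/
def RestrFreeExp {m : ℕ} (T : Submodule K (Fin ℓ → K))
    (A : Finset (Submodule K (Fin ℓ → K))) (e : Fin m → ℕ) : Prop :=
  ∃ eqv : T ≃ₗ[K] (Fin m → K), IsFreeExp (transport T eqv A) e

/-- The multiset of exponents. -/
def expMS {n : ℕ} (e : Fin n → ℕ) : Multiset ℕ := Finset.univ.val.map e

/-- `D(A)` has projective dimension at most 1: some finite generating set has a free
(possibly zero) syzygy module, i.e. there is a free resolution
`0 → S^m → S^n → D(A) → 0`. -/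
def PdimLEOne (A : Finset (Submodule K (Fin ℓ → K))) : Prop :=
  ∃ (n m : ℕ) (θ : Fin n → Deriv K ℓ) (r : Fin m → Fin n → MvPolynomial (Fin ℓ) K),
    GeneratesD A θ ∧
    (∀ j, (∑ i, r j i • θ i) = 0) ∧
    (∀ c : Fin n → MvPolynomial (Fin ℓ) K, (∑ i, c i • θ i) = 0 →
      ∃ q : Fin m → MvPolynomial (Fin ℓ) K, ∀ i, c i = ∑ j, q j * r j i) ∧
    (∀ q : Fin m → MvPolynomial (Fin ℓ) K, (∀ i, (∑ j, q j * r j i) = 0) → ∀ j, q j = 0)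

/-- `A` has a free filtration `∅ = A₀ ⊂ A₁ ⊂ ⋯ ⊂ A_n = A`, `|A_i| = i`, each `A_i` free. -/
def HasFreeFiltration (A : Finset (Submodule K (Fin ℓ → K))) : Prop :=
  ∃ c : ℕ → Finset (Submodule K (Fin ℓ → K)),
    c A.card = A ∧ (∀ i ≤ A.card, (c i).card = i ∧ IsFree (c i)) ∧
    ∀ i < A.card, c i ⊆ c (i + 1)

/-- The intersection lattices of `A` and `B` are isomorphic: there is a bijection of
hyperplanes preserving the rank of every subset (equivalently, a lattice isomorphism). -/
def LatticeEquiv (A B : Finset (Submodule K (Fin ℓ → K))) : Prop :=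
  ∃ σ : Submodule K (Fin ℓ → K) → Submodule K (Fin ℓ → K),
    Set.BijOn σ ↑A ↑B ∧
    ∀ T ⊆ A, Module.finrank K ((T.inf id : Submodule K (Fin ℓ → K))) =
      Module.finrank K (((T.image σ).inf id : Submodule K (Fin ℓ → K)))


section forms
variable {K : Type} [Field K] {ℓ : ℕ}

lemma linPoly_add (φ ψ : Module.Dual K (Fin ℓ → K)) :
    linPoly (φ + ψ) = linPoly φ + linPoly ψ := by
  simp [linPoly, add_mul, Finset.sum_add_distrib]

lemma linPoly_smul (c : K) (φ : Module.Dual K (Fin ℓ → K)) :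
    linPoly (c • φ) = C c * linPoly φ := by
  simp [linPoly, mul_assoc, Finset.mul_sum]

lemma linPoly_zero : linPoly (0 : Module.Dual K (Fin ℓ → K)) = 0 := by
  simp [linPoly]

lemma applyLin_add (θ : Deriv K ℓ) (φ ψ : Module.Dual K (Fin ℓ → K)) :
    applyLin θ (φ + ψ) = applyLin θ φ + applyLin θ ψ := by
  simp [applyLin, add_mul, Finset.sum_add_distrib]

lemma applyLin_smul (θ : Deriv K ℓ) (c : K) (φ : Module.Dual K (Fin ℓ → K)) :
    applyLin θ (c • φ) = C c * applyLin θ φ := by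
  simp [applyLin, mul_assoc, Finset.mul_sum]

/-- evaluation of derivations at a form, as an `S`-linear map -/
def evL (φ : Module.Dual K (Fin ℓ → K)) :
    Deriv K ℓ →ₗ[MvPolynomial (Fin ℓ) K] MvPolynomial (Fin ℓ) K where
  toFun θ := applyLin θ φ
  map_add' := by intro a b; simp [applyLin, mul_add, Finset.sum_add_distrib]
  map_smul' := by
    intro a b
    simp only [applyLin, Pi.smul_apply, smul_eq_mul, RingHom.id_apply, Finset.mul_sum]
    exact Finset.sum_congr rfl fun i _ => by ring

lemma linPoly_injective (φ : Module.Dual K (Fin ℓ → K)) (h : linPoly φ = 0) : φ = 0 := by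
  refine (Pi.basisFun K (Fin ℓ)).ext fun i => ?_
  have := congrArg (coeff (Finsupp.single i 1)) h
  simp only [linPoly, coeff_sum, coeff_C_mul, coeff_X] at this
  simpa [Finsupp.single_left_inj, Finset.sum_ite_eq] using this

/-- A chosen projection onto `X`. -/
lemma exists_proj (X : Submodule K (Fin ℓ → K)) :
    ∃ π : (Fin ℓ → K) →ₗ[K] (Fin ℓ → K), (∀ v, π v ∈ X) ∧ ∀ v ∈ X, π v = v := by
  obtain ⟨g, hg⟩ := X.exists_isCompl
  obtain ⟨r, hr⟩ := X.subtype.exists_leftInverse_of_injective (Submodule.ker_subtype X)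
  refine ⟨X.subtype ∘ₗ r, fun v => by simp, fun v hv => ?_⟩
  have := LinearMap.congr_fun hr ⟨v, hv⟩
  simp only [LinearMap.comp_apply, Submodule.subtype_apply, LinearMap.id_apply] at this ⊢
  rw [this]

def prj (X : Submodule K (Fin ℓ → K)) : (Fin ℓ → K) →ₗ[K] (Fin ℓ → K) :=
  Classical.choose (exists_proj X)

lemma prj_mem (X : Submodule K (Fin ℓ → K)) (v) : prj X v ∈ X :=
  (Classical.choose_spec (exists_proj X)).1 v

lemma prj_eq (X : Submodule K (Fin ℓ → K)) (v) (h : v ∈ X) : prj X v = v :=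
  (Classical.choose_spec (exists_proj X)).2 v h

/-- substitution along the projection -/
def sg (X : Submodule K (Fin ℓ → K)) : MvPolynomial (Fin ℓ) K →ₐ[K] MvPolynomial (Fin ℓ) K :=
  aeval fun i => linPoly (LinearMap.proj i ∘ₗ prj X)

lemma sum_C_linPoly (φ : Module.Dual K (Fin ℓ → K)) (q : Fin ℓ → Module.Dual K (Fin ℓ → K)) :
    ∑ i, C (φ (Pi.single i 1)) * linPoly (q i) = linPoly (∑ i, φ (Pi.single i 1) • q i) := by
  have h0 : ∀ s : Finset (Fin ℓ), ∑ i ∈ s, C (φ (Pi.single i 1)) * linPoly (q i)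
      = linPoly (∑ i ∈ s, φ (Pi.single i 1) • q i) := by
    intro s
    induction s using Finset.induction_on with
    | empty => simp [linPoly_zero]
    | insert a s ha ih => rw [Finset.sum_insert ha, Finset.sum_insert ha, linPoly_add, ih,
        linPoly_smul]
  exact h0 _

lemma sg_linPoly (X : Submodule K (Fin ℓ → K)) (φ : Module.Dual K (Fin ℓ → K)) :
    sg X (linPoly φ) = linPoly (φ ∘ₗ prj X) := by
  have : sg X (linPoly φ) = ∑ i, C (φ (Pi.single i 1)) * linPoly (LinearMap.proj i ∘ₗ prj X) := by
    simp [linPoly, sg, algebraMap_eq]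
  rw [this, sum_C_linPoly]
  congr 1
  ext v
  simp only [LinearMap.coe_comp, Function.comp_apply, LinearMap.coe_sum, Finset.sum_apply,
    LinearMap.smul_apply, LinearMap.proj_apply, smul_eq_mul, LinearMap.coe_single]
  have h : prj X (Pi.single v 1) = ∑ i, (prj X (Pi.single v 1) i) • Pi.single i (1:K) := by
    simpa using (pi_eq_sum_univ' (prj X (Pi.single v 1)))
  conv_rhs => rw [h]
  simp [map_sum, mul_comm]

lemma sg_linPoly_eq_zero_iff (X : Submodule K (Fin ℓ → K)) (φ : Module.Dual K (Fin ℓ → K)) :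
    sg X (linPoly φ) = 0 ↔ X ≤ LinearMap.ker φ := by
  rw [sg_linPoly]
  constructor
  · intro h v hv
    have := LinearMap.congr_fun (linPoly_injective _ h) v
    simpa [prj_eq X v hv] using this
  · intro h
    have : φ ∘ₗ prj X = 0 := by
      apply LinearMap.ext
      intro v
      exact h (prj_mem X v)
    rw [this, linPoly_zero]

lemma X_eq_linPoly (i : Fin ℓ) : (X i : MvPolynomial (Fin ℓ) K) =
    linPoly (LinearMap.proj i : (Fin ℓ → K) →ₗ[K] K) := by
  simp [linPoly, Pi.single_apply]

lemma sub_sg_mem (X : Submodule K (Fin ℓ → K)) (I : Ideal (MvPolynomial (Fin ℓ) K))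
    (hI : ∀ φ : Module.Dual K (Fin ℓ → K), X ≤ LinearMap.ker φ → linPoly φ ∈ I)
    (f : MvPolynomial (Fin ℓ) K) : f - sg X f ∈ I := by
  induction f using MvPolynomial.induction_on with
  | C a => simp [sg, algebraMap_eq]
  | add p q hp hq =>
    have := I.add_mem hp hq
    rw [map_add]
    convert this using 1
    ring
  | mul_X p i hp =>
    have h1 : MvPolynomial.X i - sg X (MvPolynomial.X i) ∈ I := by
      rw [X_eq_linPoly, sg_linPoly]
      set q : Module.Dual K (Fin ℓ → K) := LinearMap.proj i with hq
      have h2 : linPoly q - linPoly (q ∘ₗ prj X) = linPoly (q + (-1 : K) • (q ∘ₗ prj X)) := by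
        rw [linPoly_add, linPoly_smul]; simp [sub_eq_add_neg]
      rw [h2]
      apply hI
      intro v hv
      simp [prj_eq X v hv]
    rw [map_mul]
    have := I.add_mem (I.mul_mem_right (MvPolynomial.X i) hp) (I.mul_mem_left (sg X p) h1)
    convert this using 1
    ring

lemma mem_of_sg (X : Submodule K (Fin ℓ → K)) (I : Ideal (MvPolynomial (Fin ℓ) K))
    (hI : ∀ φ : Module.Dual K (Fin ℓ → K), X ≤ LinearMap.ker φ → linPoly φ ∈ I)
    (f g : MvPolynomial (Fin ℓ) K) (hg : g ∈ I) (h : sg X f = sg X g) : f ∈ I := by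
  have h1 := sub_sg_mem X I hI f
  have h2 := sub_sg_mem X I hI g
  have := I.add_mem (I.sub_mem h1 h2) hg
  rw [h] at this
  convert this using 1
  ring

lemma sg_idem (X : Submodule K (Fin ℓ → K)) (f : MvPolynomial (Fin ℓ) K) :
    sg X (sg X f) = sg X f := by
  have : sg X (f - sg X f) = 0 := by
    have := sub_sg_mem X (RingHom.ker (sg X).toRingHom) (fun φ h => by
      rw [RingHom.mem_ker]; exact (sg_linPoly_eq_zero_iff X φ).2 h) f
    rw [RingHom.mem_ker] at this
    exact this
  rw [map_sub, sub_eq_zero] at this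
  exact this.symm

lemma exists_smul_of_ker_le (φ ψ : Module.Dual K (Fin ℓ → K))
    (h : LinearMap.ker φ ≤ LinearMap.ker ψ) : ∃ c : K, ψ = c • φ := by
  have := mem_span_of_iInf_ker_le_ker (L := fun _ : Fin 1 => φ) (K := ψ) (by simpa using h)
  simp only [Set.range_const, Submodule.mem_span_singleton] at this
  obtain ⟨c, hc⟩ := this
  exact ⟨c, hc.symm⟩

lemma exists_comb_of_ker_le (φ χ ψ : Module.Dual K (Fin ℓ → K))
    (h : LinearMap.ker φ ⊓ LinearMap.ker χ ≤ LinearMap.ker ψ) : ∃ a b : K, ψ = a • φ + b • χ := by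
  have := mem_span_of_iInf_ker_le_ker (L := ![φ, χ]) (K := ψ) (by
    refine le_trans ?_ h
    exact le_inf (iInf_le (fun i => LinearMap.ker ((![φ, χ] : Fin 2 → _) i)) 0)
      (iInf_le (fun i => LinearMap.ker ((![φ, χ] : Fin 2 → _) i)) 1))
  simp only [Matrix.range_cons, Matrix.range_empty, Set.union_empty, Set.union_singleton] at this
  rw [Submodule.mem_span_pair] at this
  obtain ⟨a, b, hc⟩ := this
  exact ⟨b, a, by rw [← hc, add_comm]⟩

/-- membership in `(α)` -/
lemma dvd_iff_sg (φ : Module.Dual K (Fin ℓ → K)) (f : MvPolynomial (Fin ℓ) K) :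
    linPoly φ ∣ f ↔ sg (LinearMap.ker φ) f = 0 := by
  constructor
  · rintro ⟨g, rfl⟩
    rw [map_mul, (sg_linPoly_eq_zero_iff _ φ).2 le_rfl, zero_mul]
  · intro h
    rw [← Ideal.mem_span_singleton]
    refine mem_of_sg (LinearMap.ker φ) _ (fun ψ hψ => ?_) f 0 (Ideal.zero_mem _) (by simpa using h)
    obtain ⟨c, rfl⟩ := exists_smul_of_ker_le φ ψ hψ
    rw [linPoly_smul]
    exact Ideal.mul_mem_left _ _ (Ideal.mem_span_singleton_self _)

/-- membership in `(α, p)` -/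
lemma mem_pair_iff_sg (φ χ : Module.Dual K (Fin ℓ → K)) (f : MvPolynomial (Fin ℓ) K) :
    f ∈ Ideal.span {linPoly φ} ⊔ Ideal.span {linPoly χ} ↔
      sg (LinearMap.ker φ ⊓ LinearMap.ker χ) f = 0 := by
  constructor
  · intro h
    have : Ideal.span {linPoly φ} ⊔ Ideal.span {linPoly χ} ≤
        RingHom.ker (sg (LinearMap.ker φ ⊓ LinearMap.ker χ)).toRingHom := by
      rw [sup_le_iff, Ideal.span_singleton_le_iff_mem, Ideal.span_singleton_le_iff_mem,
        RingHom.mem_ker, RingHom.mem_ker]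
      exact ⟨(sg_linPoly_eq_zero_iff _ φ).2 inf_le_left, (sg_linPoly_eq_zero_iff _ χ).2 inf_le_right⟩
    exact this h
  · intro h
    refine mem_of_sg (LinearMap.ker φ ⊓ LinearMap.ker χ) _ (fun ψ hψ => ?_) f 0 (Ideal.zero_mem _)
      (by simpa using h)
    obtain ⟨a, b, rfl⟩ := exists_comb_of_ker_le φ χ ψ hψ
    rw [linPoly_add, linPoly_smul, linPoly_smul]
    exact Ideal.add_mem _
      (Ideal.mem_sup_left (Ideal.mul_mem_left _ _ (Ideal.mem_span_singleton_self _)))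
      (Ideal.mem_sup_right (Ideal.mul_mem_left _ _ (Ideal.mem_span_singleton_self _)))

/-- membership in `(α, B)` -/
lemma mem_sup_of_sg_dvd (φ : Module.Dual K (Fin ℓ → K)) (B f : MvPolynomial (Fin ℓ) K)
    (h : sg (LinearMap.ker φ) B ∣ sg (LinearMap.ker φ) f) :
    f ∈ Ideal.span {linPoly φ} ⊔ Ideal.span {B} := by
  obtain ⟨g, hg⟩ := h
  refine mem_of_sg (LinearMap.ker φ) _ (fun ψ hψ => ?_) f (B * g)
    (Ideal.mem_sup_right (Ideal.mul_mem_right _ _ (Ideal.mem_span_singleton_self _))) ?_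
  · obtain ⟨c, rfl⟩ := exists_smul_of_ker_le φ ψ hψ
    rw [linPoly_smul]
    exact Ideal.mem_sup_left (Ideal.mul_mem_left _ _ (Ideal.mem_span_singleton_self _))
  · have := congrArg (sg (LinearMap.ker φ)) hg
    rw [sg_idem, map_mul, sg_idem] at this
    rw [this, map_mul]

lemma linPoly_prime (φ : Module.Dual K (Fin ℓ → K)) (h : φ ≠ 0) : Prime (linPoly φ) := by
  refine ⟨fun h0 => h (linPoly_injective φ h0), fun hu => ?_, fun a b hab => ?_⟩
  · have : linPoly φ ∣ 1 := hu.dvd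
    rw [dvd_iff_sg] at this
    simp at this
  · simp only [dvd_iff_sg, map_mul, mul_eq_zero] at hab ⊢
    exact hab

lemma linPoly_relPrime (φ ψ : Module.Dual K (Fin ℓ → K)) (h : φ ≠ 0)
    (hk : ¬ LinearMap.ker φ ≤ LinearMap.ker ψ) : IsRelPrime (linPoly φ) (linPoly ψ) := by
  rw [(linPoly_prime φ h).irreducible.isRelPrime_iff_not_dvd, dvd_iff_sg, sg_linPoly_eq_zero_iff]
  exact hk

end forms

section grading
variable {K : Type} [Field K] {ℓ : ℕ}

/-- the degree `m` piece of `S`, `m : ℤ` -/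
def Sh (K : Type) [Field K] (ℓ : ℕ) (m : ℤ) : Submodule K (MvPolynomial (Fin ℓ) K) :=
  weightedHomogeneousSubmodule K (fun _ => (1 : ℤ)) m

/-- the degree `m` component -/
def cmp (m : ℤ) : MvPolynomial (Fin ℓ) K →ₗ[K] MvPolynomial (Fin ℓ) K :=
  weightedHomogeneousComponent (fun _ => (1 : ℤ)) m

lemma cmp_mem (m : ℤ) (f : MvPolynomial (Fin ℓ) K) : cmp m f ∈ Sh K ℓ m :=
  weightedHomogeneousComponent_mem _ _ _

lemma cmp_same {m : ℤ} {f : MvPolynomial (Fin ℓ) K} (h : f ∈ Sh K ℓ m) : cmp m f = f :=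
  IsWeightedHomogeneous.weightedHomogeneousComponent_same h

lemma cmp_ne {m n : ℤ} {f : MvPolynomial (Fin ℓ) K} (h : f ∈ Sh K ℓ m) (hn : m ≠ n) :
    cmp n f = 0 :=
  IsWeightedHomogeneous.weightedHomogeneousComponent_ne n h hn.symm

lemma Sh_mul {m n : ℤ} {f g : MvPolynomial (Fin ℓ) K} (hf : f ∈ Sh K ℓ m) (hg : g ∈ Sh K ℓ n) :
    f * g ∈ Sh K ℓ (m + n) := IsWeightedHomogeneous.mul hf hg

lemma weight_one (d : Fin ℓ →₀ ℕ) :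
    Finsupp.weight (fun _ : Fin ℓ => (1 : ℤ)) d = ((Finsupp.degree d : ℕ) : ℤ) := by
  simp [Finsupp.weight_apply, Finsupp.degree_apply, Finsupp.sum]

lemma Sh_of_homog {n : ℕ} {f : MvPolynomial (Fin ℓ) K} (h : f.IsHomogeneous n) :
    f ∈ Sh K ℓ n := by
  intro d hd
  have := h hd
  rw [weight_one]
  rw [Finsupp.degree_eq_weight_one]
  exact_mod_cast this

lemma cmp_mul {d : ℤ} {f : MvPolynomial (Fin ℓ) K} (hf : f ∈ Sh K ℓ d)
    (g : MvPolynomial (Fin ℓ) K) (m : ℤ) : cmp m (f * g) = f * cmp (m - d) g := by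
  induction g using MvPolynomial.induction_on' with
  | monomial u a =>
    have hu : monomial u a ∈ Sh K ℓ (Finsupp.weight (fun _ => (1:ℤ)) u) :=
      isWeightedHomogeneous_monomial _ _ _ rfl
    by_cases h : m - d = Finsupp.weight (fun _ => (1:ℤ)) u
    · rw [h, cmp_same hu, cmp_same]
      have := Sh_mul hf hu
      rwa [← h, add_sub_cancel] at this
    · rw [cmp_ne hu (Ne.symm h), mul_zero]
      refine cmp_ne (Sh_mul hf hu) ?_
      intro h'; apply h; omega
  | add p q hp hq => rw [mul_add, map_add, map_add, mul_add, hp, hq]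

lemma cmp_sum_zero {f : MvPolynomial (Fin ℓ) K} (h : ∀ m, cmp m f = 0) : f = 0 := by
  have := sum_weightedHomogeneousComponent (R := K) (fun _ : Fin ℓ => (1:ℤ)) f
  rw [← this]
  refine finsum_eq_zero_of_forall_eq_zero h

lemma linPoly_mem (φ : Module.Dual K (Fin ℓ → K)) : linPoly φ ∈ Sh K ℓ 1 := by
  refine Submodule.sum_mem _ fun i _ => ?_
  rw [← smul_eq_C_mul]
  refine Submodule.smul_mem _ _ ?_
  exact isWeightedHomogeneous_X _ _ _

lemma prod_mem {ι : Type*} (s : Finset ι) (p : ι → MvPolynomial (Fin ℓ) K)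
    (h : ∀ i ∈ s, p i ∈ Sh K ℓ 1) : ∏ i ∈ s, p i ∈ Sh K ℓ (s.card : ℤ) := by
  have := IsWeightedHomogeneous.prod s p (fun _ => (1:ℤ)) (w := fun _ => (1:ℤ)) h
  simp only [Finset.sum_const, nsmul_eq_mul, mul_one] at this
  exact this

lemma Sh_neg {m : ℤ} (hm : m < 0) : Sh K ℓ m = ⊥ := by
  rw [eq_bot_iff]
  intro f hf
  rw [Submodule.mem_bot]
  ext d
  by_contra h
  have := hf h
  rw [weight_one] at this
  omega

lemma Sh_eq_supported (n : ℕ) : Sh K ℓ (n : ℤ) = homogeneousSubmodule (Fin ℓ) K n := by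
  ext f
  constructor
  · intro h d hd
    have := h hd
    rw [weight_one, Finsupp.degree_eq_weight_one] at this
    exact_mod_cast this
  · intro h; exact Sh_of_homog h

def degSet (ℓ n : ℕ) : Finset (Fin ℓ →₀ ℕ) :=
  ((Fintype.piFinset fun _ : Fin ℓ => Finset.range (n + 1))).map
    (Finsupp.equivFunOnFinite.symm.toEmbedding)

lemma card_degSet (ℓ n : ℕ) : (degSet ℓ n).card = (n + 1) ^ ℓ := by
  simp [degSet]

lemma Sh_le_span (n : ℕ) : Sh K ℓ (n : ℤ) ≤
    Submodule.span K ((fun d => monomial d (1:K)) '' (degSet ℓ n : Set (Fin ℓ →₀ ℕ))) := by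
  intro f hf
  rw [f.as_sum]
  refine Submodule.sum_mem _ fun d hd => ?_
  have h1 : monomial d (coeff d f) = coeff d f • monomial d (1:K) := by
    rw [smul_monomial]; simp
  rw [h1]
  refine Submodule.smul_mem _ _ (Submodule.subset_span ⟨d, ?_, rfl⟩)
  have := hf (mem_support_iff.1 hd)
  rw [weight_one] at this
  simp only [degSet, Finset.coe_map, Set.mem_image, Finset.mem_coe, Fintype.mem_piFinset,
    Finset.mem_range]
  refine ⟨d, fun i => ?_, by simp⟩
  have := Finsupp.le_degree i d
  omega

lemma finSpan (n : ℕ) : Module.Finite K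
    (Submodule.span K ((fun d => monomial d (1:K)) '' (degSet ℓ n : Set (Fin ℓ →₀ ℕ)))) :=
  FiniteDimensional.span_of_finite K ((Finset.finite_toSet _).image _)

instance Sh_fin (m : ℤ) : Module.Finite K (Sh K ℓ m) := by
  by_cases h : m < 0
  · rw [Sh_neg h]; infer_instance
  · obtain ⟨n, rfl⟩ := Int.eq_ofNat_of_zero_le (not_lt.1 h)
    have := finSpan (K := K) (ℓ := ℓ) n
    exact Submodule.finiteDimensional_of_le (Sh_le_span n)

/-- Hilbert function of `S` -/
def hS (K : Type) [Field K] (ℓ : ℕ) (m : ℤ) : ℕ := Module.finrank K (Sh K ℓ m)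

lemma hS_neg {m : ℤ} (hm : m < 0) : hS K ℓ m = 0 := by
  rw [hS, Sh_neg hm]; simp

lemma hS_le (n : ℕ) : hS K ℓ n ≤ (n + 1) ^ ℓ := by
  have := finSpan (K := K) (ℓ := ℓ) n
  refine (Submodule.finrank_mono (Sh_le_span n)).trans ?_
  rw [← Finset.coe_image]
  refine (finrank_span_finset_le_card _).trans ?_
  exact Finset.card_image_le.trans (card_degSet ℓ n).le

lemma hS_zero : 1 ≤ hS K ℓ 0 := by
  rw [hS, Nat.one_le_iff_ne_zero, Ne, Submodule.finrank_eq_zero]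
  intro h
  have : (1 : MvPolynomial (Fin ℓ) K) ∈ Sh K ℓ 0 := isWeightedHomogeneous_one _ _
  rw [h] at this
  simp at this

end grading

section hilb
variable {K : Type} [Field K] {ℓ : ℕ}

/-- Homogeneous ideals -/
def HomI (I : Ideal (MvPolynomial (Fin ℓ) K)) : Prop := ∀ x ∈ I, ∀ m, cmp m x ∈ I

lemma HomI_bot : HomI (⊥ : Ideal (MvPolynomial (Fin ℓ) K)) := by
  intro x hx m
  rw [Ideal.mem_bot] at hx ⊢
  rw [hx, map_zero]

lemma HomI_sup {I J : Ideal (MvPolynomial (Fin ℓ) K)} (hI : HomI I) (hJ : HomI J) :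
    HomI (I ⊔ J) := by
  intro x hx m
  obtain ⟨a, ha, b, hb, rfl⟩ := Submodule.mem_sup.1 hx
  rw [map_add]
  exact Ideal.add_mem _ (Ideal.mem_sup_left (hI _ ha m)) (Ideal.mem_sup_right (hJ _ hb m))

lemma HomI_span {d : ℤ} {f : MvPolynomial (Fin ℓ) K} (hf : f ∈ Sh K ℓ d) :
    HomI (Ideal.span {f}) := by
  intro x hx m
  obtain ⟨g, rfl⟩ := Ideal.mem_span_singleton.1 hx
  rw [cmp_mul hf]
  exact Ideal.mul_mem_right _ _ (Ideal.mem_span_singleton_self _)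

/-- degree `m` part of an ideal -/
def Ipc (I : Ideal (MvPolynomial (Fin ℓ) K)) (m : ℤ) : Submodule K (MvPolynomial (Fin ℓ) K) :=
  Sh K ℓ m ⊓ I.restrictScalars K

instance Ipc_fin (I : Ideal (MvPolynomial (Fin ℓ) K)) (m : ℤ) : Module.Finite K (Ipc I m) :=
  Submodule.finiteDimensional_of_le (inf_le_left : _ ≤ Sh K ℓ m)

lemma mem_Ipc {I : Ideal (MvPolynomial (Fin ℓ) K)} {m : ℤ} {x} :
    x ∈ Ipc I m ↔ x ∈ Sh K ℓ m ∧ x ∈ I := by simp [Ipc]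

def hd (I : Ideal (MvPolynomial (Fin ℓ) K)) (m : ℤ) : ℕ := Module.finrank K (Ipc I m)

lemma hd_mono {I J : Ideal (MvPolynomial (Fin ℓ) K)} (h : I ≤ J) (m : ℤ) : hd I m ≤ hd J m :=
  Submodule.finrank_mono (fun x hx => by rw [mem_Ipc] at hx ⊢; exact ⟨hx.1, h hx.2⟩)

lemma hd_le (I : Ideal (MvPolynomial (Fin ℓ) K)) (m : ℤ) : hd I m ≤ hS K ℓ m :=
  Submodule.finrank_mono inf_le_left

lemma hd_bot (m : ℤ) : hd (⊥ : Ideal (MvPolynomial (Fin ℓ) K)) m = 0 := by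
  rw [hd, Submodule.finrank_eq_zero, eq_bot_iff]
  intro x hx
  exact (mem_Ipc.1 hx).2

def coln (I : Ideal (MvPolynomial (Fin ℓ) K)) (f : MvPolynomial (Fin ℓ) K) :
    Ideal (MvPolynomial (Fin ℓ) K) := Submodule.comap (LinearMap.mulLeft _ f) I

lemma mem_coln {I : Ideal (MvPolynomial (Fin ℓ) K)} {f g : MvPolynomial (Fin ℓ) K} :
    g ∈ coln I f ↔ f * g ∈ I := by simp [coln]

lemma hd_sup (I : Ideal (MvPolynomial (Fin ℓ) K)) (hI : HomI I) {d : ℤ}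
    {f : MvPolynomial (Fin ℓ) K} (hf : f ∈ Sh K ℓ d) (f0 : f ≠ 0) (m : ℤ) :
    hd (I ⊔ Ideal.span {f}) m + hd (coln I f) (m - d) = hd I m + hS K ℓ (m - d) := by
  have inj : Function.Injective (LinearMap.mulLeft K f) := fun a b h => by
    simpa [f0] using h
  have e1 : Ipc (I ⊔ Ideal.span {f}) m = Ipc I m ⊔ (Sh K ℓ (m - d)).map (LinearMap.mulLeft K f) := by
    ext x
    rw [mem_Ipc]
    constructor
    · rintro ⟨hx, hxI⟩
      obtain ⟨a, ha, b, hb, rfl⟩ := Submodule.mem_sup.1 hxI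
      obtain ⟨g, rfl⟩ := Ideal.mem_span_singleton.1 hb
      rw [← cmp_same hx, map_add, cmp_mul hf]
      refine Submodule.add_mem_sup (mem_Ipc.2 ⟨cmp_mem _ _, hI _ ha _⟩) ⟨_, cmp_mem _ _, rfl⟩
    · intro hx
      obtain ⟨a, ha, b, ⟨g, hg, rfl⟩, rfl⟩ := Submodule.mem_sup.1 hx
      rw [mem_Ipc] at ha
      have h2 := Sh_mul hf hg
      rw [add_sub_cancel] at h2
      exact ⟨Submodule.add_mem _ ha.1 h2, Ideal.add_mem _ (Ideal.mem_sup_left ha.2)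
        (Ideal.mem_sup_right (Ideal.mul_mem_right _ _ (Ideal.mem_span_singleton_self _)))⟩
  have e2 : Ipc I m ⊓ (Sh K ℓ (m - d)).map (LinearMap.mulLeft K f) =
      (Ipc (coln I f) (m - d)).map (LinearMap.mulLeft K f) := by
    ext x
    constructor
    · rintro ⟨hx, ⟨g, hg, rfl⟩⟩
      exact ⟨g, mem_Ipc.2 ⟨hg, mem_coln.2 (mem_Ipc.1 hx).2⟩, rfl⟩
    · rintro ⟨g, hg, rfl⟩
      have hg := mem_Ipc.1 hg
      have h2 := Sh_mul hf hg.1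
      rw [add_sub_cancel] at h2
      exact ⟨mem_Ipc.2 ⟨h2, mem_coln.1 hg.2⟩, ⟨g, hg.1, rfl⟩⟩
  have := Submodule.finrank_sup_add_finrank_inf_eq (Ipc I m)
    ((Sh K ℓ (m - d)).map (LinearMap.mulLeft K f))
  rw [← e1, e2, ← (Submodule.equivMapOfInjective _ inj (Sh K ℓ (m - d))).finrank_eq,
    ← (Submodule.equivMapOfInjective _ inj (Ipc (coln I f) (m - d))).finrank_eq] at this
  exact this

/-- generating series -/
def HS (a : ℤ → ℕ) (t : ℝ) : ℝ := ∑' m : ℤ, (a m : ℝ) * t ^ m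

lemma summable_hS {t : ℝ} (h0 : 0 < t) (h1 : t < 1) :
    Summable fun m : ℤ => (hS K ℓ m : ℝ) * t ^ m := by
  have hinj : Function.Injective (Nat.cast : ℕ → ℤ) := Nat.cast_injective
  rw [← hinj.summable_iff]
  · have h2 : Summable fun n : ℕ => ((n : ℝ) + 1) ^ ℓ * t ^ n := by
      have h3 := summable_pow_mul_geometric_of_norm_lt_one (R := ℝ) ℓ (r := t)
        (by rw [Real.norm_eq_abs, abs_of_pos h0]; exact h1)
      have h4 := (summable_nat_add_iff 1).2 h3
      have h5 := h4.mul_left t⁻¹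
      refine h5.congr fun n => ?_
      push_cast
      rw [pow_succ]
      field_simp
    refine Summable.of_nonneg_of_le (fun n => ?_) (fun n => ?_) h2
    · simp only [Function.comp]; positivity
    · simp only [Function.comp, zpow_natCast]
      gcongr
      exact_mod_cast hS_le n
  · intro m hm
    have : m < 0 := by
      by_contra h
      obtain ⟨n, rfl⟩ := Int.eq_ofNat_of_zero_le (not_lt.1 h)
      exact hm ⟨n, rfl⟩
    rw [hS_neg this]; simp

lemma summable_of_le {t : ℝ} (h0 : 0 < t) (h1 : t < 1) (a : ℤ → ℕ) (N : ℕ)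
    (ha : ∀ m, a m ≤ N * hS K ℓ m) :
    Summable fun m : ℤ => (a m : ℝ) * t ^ m := by
  refine Summable.of_nonneg_of_le (fun n => by positivity) (fun n => ?_)
    ((summable_hS (K := K) (ℓ := ℓ) h0 h1).mul_left (N : ℝ))
  rw [← mul_assoc]
  gcongr
  exact_mod_cast ha n

lemma shift_fun {t : ℝ} (h0 : 0 < t) (a : ℤ → ℕ) (d : ℕ) :
    (fun m : ℤ => (a (m - d) : ℝ) * t ^ m) =
      (fun m : ℤ => t ^ d * ((a m : ℝ) * t ^ m)) ∘ (Equiv.subRight (d : ℤ)) := by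
  funext m
  simp only [Function.comp, Equiv.subRight_apply]
  rw [zpow_sub₀ h0.ne', zpow_natCast]
  field_simp

lemma HS_shift {t : ℝ} (h0 : 0 < t) (a : ℤ → ℕ) (d : ℕ) :
    HS (fun m => a (m - d)) t = t ^ d * HS a t := by
  unfold HS
  rw [shift_fun h0, ← tsum_mul_left]
  exact (Equiv.subRight (d : ℤ)).tsum_eq (fun m : ℤ => t ^ d * ((a m : ℝ) * t ^ m))

lemma summable_shift {t : ℝ} (h0 : 0 < t) (a : ℤ → ℕ) (d : ℕ)
    (h : Summable fun m : ℤ => (a m : ℝ) * t ^ m) :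
    Summable fun m : ℤ => (a (m - d) : ℝ) * t ^ m := by
  rw [shift_fun h0]
  exact (Equiv.subRight (d : ℤ)).summable_iff.2 (h.mul_left _)

lemma HS_add {t : ℝ} {a b : ℤ → ℕ} (ha : Summable fun m : ℤ => (a m : ℝ) * t ^ m)
    (hb : Summable fun m : ℤ => (b m : ℝ) * t ^ m) :
    HS (fun m => a m + b m) t = HS a t + HS b t := by
  unfold HS
  rw [← ha.tsum_add hb]
  congr 1; funext m; push_cast; ring

lemma HS_mono {t : ℝ} (h0 : 0 < t) {a b : ℤ → ℕ} (ha : Summable fun m : ℤ => (a m : ℝ) * t ^ m)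
    (hb : Summable fun m : ℤ => (b m : ℝ) * t ^ m) (h : ∀ m, a m ≤ b m) : HS a t ≤ HS b t := by
  refine ha.tsum_le_tsum (fun m => ?_) hb
  gcongr
  exact h m

lemma HS_hS_pos {t : ℝ} (h0 : 0 < t) (h1 : t < 1) : 0 < HS (hS K ℓ) t := by
  refine (summable_hS h0 h1).tsum_pos (fun m => by positivity) 0 ?_
  have : 1 ≤ hS K ℓ 0 := hS_zero
  have : (1:ℝ) ≤ hS K ℓ 0 := by exact_mod_cast this
  simp; linarith

lemma summable_hd {t : ℝ} (h0 : 0 < t) (h1 : t < 1) (I : Ideal (MvPolynomial (Fin ℓ) K)) :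
    Summable fun m : ℤ => (hd I m : ℝ) * t ^ m :=
  summable_of_le (K := K) (ℓ := ℓ) h0 h1 _ 1 (fun m => by rw [one_mul]; exact hd_le I m)

lemma HS_sup {t : ℝ} (h0 : 0 < t) (h1 : t < 1)
    (I : Ideal (MvPolynomial (Fin ℓ) K)) (hI : HomI I) {d : ℕ}
    {f : MvPolynomial (Fin ℓ) K} (hf : f ∈ Sh K ℓ (d : ℤ)) (f0 : f ≠ 0) :
    HS (hd (I ⊔ Ideal.span {f})) t + t ^ d * HS (hd (coln I f)) t =
      HS (hd I) t + t ^ d * HS (hS K ℓ) t := by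
  rw [← HS_shift h0, ← HS_shift h0, ← HS_add (summable_hd h0 h1 _)
    (summable_shift h0 _ _ (summable_hd h0 h1 _)), ← HS_add (summable_hd h0 h1 _)
    (summable_shift h0 _ _ (summable_hS h0 h1))]
  congr 1
  funext m
  exact hd_sup I hI hf f0 m

lemma HS_sup_prime {t : ℝ} (h0 : 0 < t) (h1 : t < 1)
    (I : Ideal (MvPolynomial (Fin ℓ) K)) (hI : HomI I) {d : ℕ}
    {f : MvPolynomial (Fin ℓ) K} (hf : f ∈ Sh K ℓ (d : ℤ))
    (f0 : f ≠ 0) (hnz : ∀ g, f * g ∈ I → g ∈ I) :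
    HS (hS K ℓ) t - HS (hd (I ⊔ Ideal.span {f})) t =
      (1 - t ^ d) * (HS (hS K ℓ) t - HS (hd I) t) := by
  have h := HS_sup h0 h1 I hI hf f0
  have : coln I f = I := by
    ext g; rw [mem_coln]; exact ⟨hnz g, fun h => Ideal.mul_mem_left _ _ h⟩
  rw [this] at h
  linear_combination -h

lemma HS_sup_le {t : ℝ} (h0 : 0 < t) (h1 : t < 1)
    (I J : Ideal (MvPolynomial (Fin ℓ) K)) (hI : HomI I) {d : ℕ}
    {f : MvPolynomial (Fin ℓ) K} (hf : f ∈ Sh K ℓ (d : ℤ)) (f0 : f ≠ 0)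
    (hJ : ∀ g ∈ J, f * g ∈ I) :
    HS (hd (I ⊔ Ideal.span {f})) t ≤ HS (hd I) t + (HS (hS K ℓ) t - HS (hd J) t) := by
  have h := HS_sup h0 h1 I hI hf f0
  have h2 : HS (hd J) t ≤ HS (hd (coln I f)) t :=
    HS_mono h0 (summable_hd h0 h1 _) (summable_hd h0 h1 _)
      (fun m => hd_mono (fun g hg => mem_coln.2 (hJ g hg)) m)
  have h3 : HS (hd J) t ≤ HS (hS K ℓ) t :=
    HS_mono h0 (summable_hd h0 h1 _) (summable_hS h0 h1) (fun m => hd_le _ m)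
  have h4 : t ^ d ≤ 1 := pow_le_one₀ h0.le h1.le
  have h5 : 0 < t ^ d := by positivity
  nlinarith [mul_le_mul_of_nonneg_left h2 h5.le]

lemma HS_lin {t : ℝ} (h0 : 0 < t) (h1 : t < 1) (φ : Module.Dual K (Fin ℓ → K)) (hφ : φ ≠ 0) :
    HS (hS K ℓ) t - HS (hd (Ideal.span {linPoly φ})) t = (1 - t) * HS (hS K ℓ) t := by
  have h := HS_sup_prime h0 h1 ⊥ HomI_bot (d := 1) (f := linPoly φ)
    (by simpa using linPoly_mem φ)
    (linPoly_prime φ hφ).ne_zero (fun g hg => by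
      rw [Ideal.mem_bot] at hg ⊢
      exact (mul_eq_zero.1 hg).resolve_left (linPoly_prime φ hφ).ne_zero)
  rw [bot_sup_eq] at h
  have h2 : HS (hd (⊥ : Ideal (MvPolynomial (Fin ℓ) K))) t = 0 := by
    simp [HS, hd_bot]
  rw [h2] at h
  simpa using h

lemma HS_lin_sup {t : ℝ} (h0 : 0 < t) (h1 : t < 1) (φ : Module.Dual K (Fin ℓ → K)) (hφ : φ ≠ 0)
    {d : ℕ} {f : MvPolynomial (Fin ℓ) K} (hf : f ∈ Sh K ℓ (d : ℤ))
    (hnd : ¬ linPoly φ ∣ f) :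
    HS (hS K ℓ) t - HS (hd (Ideal.span {linPoly φ} ⊔ Ideal.span {f})) t =
      (1 - t ^ d) * ((1 - t) * HS (hS K ℓ) t) := by
  rw [← HS_lin h0 h1 φ hφ]
  refine HS_sup_prime h0 h1 _ (HomI_span (linPoly_mem φ)) hf ?_ ?_
  · rintro rfl; exact hnd (dvd_zero _)
  · intro g hg
    rw [Ideal.mem_span_singleton] at hg ⊢
    exact ((linPoly_prime φ hφ).dvd_or_dvd hg).resolve_left hnd

lemma HS_pair_sup {t : ℝ} (h0 : 0 < t) (h1 : t < 1) (φ χ : Module.Dual K (Fin ℓ → K)) (hφ : φ ≠ 0)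
    (hχ : ¬ LinearMap.ker φ ≤ LinearMap.ker χ)
    {d : ℕ} {f : MvPolynomial (Fin ℓ) K} (hf : f ∈ Sh K ℓ (d : ℤ))
    (hnd : sg (LinearMap.ker φ ⊓ LinearMap.ker χ) f ≠ 0) :
    HS (hS K ℓ) t - HS (hd (Ideal.span {linPoly φ} ⊔ Ideal.span {linPoly χ} ⊔ Ideal.span {f})) t =
      (1 - t ^ d) * ((1 - t) * ((1 - t) * HS (hS K ℓ) t)) := by
  have h := HS_lin_sup h0 h1 φ hφ (d := 1) (f := linPoly χ) (by simpa using linPoly_mem χ)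
    (by rw [dvd_iff_sg, sg_linPoly_eq_zero_iff]; exact hχ)
  rw [pow_one] at h
  rw [← h]
  refine HS_sup_prime h0 h1 _ (HomI_sup (HomI_span (linPoly_mem φ)) (HomI_span (linPoly_mem χ)))
    hf ?_ ?_
  · rintro rfl; simp at hnd
  · intro g hg
    rw [mem_pair_iff_sg, map_mul] at hg
    rw [mem_pair_iff_sg]
    exact (mul_eq_zero.1 hg).resolve_left hnd

end hilb

section drop
variable {K : Type} [Field K] {ℓ : ℕ}

def IsHyp (L : Submodule K (Fin ℓ → K)) : Prop :=
  ∃ φ : Module.Dual K (Fin ℓ → K), φ ≠ 0 ∧ LinearMap.ker φ = L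

def frm (L : Submodule K (Fin ℓ → K)) : Module.Dual K (Fin ℓ → K) :=
  if h : IsHyp L then Classical.choose h else 0

lemma frm_ne {L : Submodule K (Fin ℓ → K)} (h : IsHyp L) : frm L ≠ 0 := by
  rw [frm, dif_pos h]; exact (Classical.choose_spec h).1

lemma frm_ker {L : Submodule K (Fin ℓ → K)} (h : IsHyp L) : LinearMap.ker (frm L) = L := by
  rw [frm, dif_pos h]; exact (Classical.choose_spec h).2

lemma InD_iff {A : Finset (Submodule K (Fin ℓ → K))} (hA : IsArrangement A) (θ : Deriv K ℓ) :
    InD A θ ↔ ∀ L ∈ A, linPoly (frm L) ∣ applyLin θ (frm L) := by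
  constructor
  · intro h L hL
    exact h L hL _ (frm_ker (hA L hL))
  · intro h L hL φ hφ
    have h1 : IsHyp L := hA L hL
    obtain ⟨c, hc⟩ := exists_smul_of_ker_le φ (frm L) (by rw [hφ, frm_ker h1])
    have c0 : c ≠ 0 := by
      rintro rfl; rw [zero_smul] at hc; exact frm_ne h1 hc
    have h2 := h L hL
    rw [hc, linPoly_smul, applyLin_smul] at h2
    have hu : IsUnit (C c : MvPolynomial (Fin ℓ) K) := (isUnit_iff_ne_zero.2 c0).map C
    rw [hu.mul_left_dvd] at h2
    exact (hu.dvd_mul_left).1 h2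

/-- `D(A)` as an `S`-submodule -/
def DS (A : Finset (Submodule K (Fin ℓ → K))) :
    Submodule (MvPolynomial (Fin ℓ) K) (Deriv K ℓ) where
  carrier := {θ | InD A θ}
  add_mem' := by
    intro a b ha hb L hL φ hφ
    have := dvd_add (ha L hL φ hφ) (hb L hL φ hφ)
    have h2 : applyLin (a + b) φ = applyLin a φ + applyLin b φ := (evL φ).map_add a b
    rwa [← h2] at this
  zero_mem' := by
    intro L hL φ hφ
    rw [show applyLin 0 φ = 0 from (evL φ).map_zero]
    exact dvd_zero _
  smul_mem' := by
    intro c a ha L hL φ hφ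
    rw [show applyLin (c • a) φ = _ from (evL φ).map_smul c a]
    exact Dvd.dvd.mul_left (ha L hL φ hφ) c

/-- homogeneous derivations -/
def HD (K : Type) [Field K] (ℓ : ℕ) (m : ℤ) : Submodule K (Deriv K ℓ) :=
  Submodule.pi Set.univ fun _ => Sh K ℓ m

lemma mem_HD {m : ℤ} {θ : Deriv K ℓ} : θ ∈ HD K ℓ m ↔ ∀ i, θ i ∈ Sh K ℓ m := by
  simp [HD]

def HDequiv (m : ℤ) : HD K ℓ m ≃ₗ[K] (Fin ℓ → Sh K ℓ m) where
  toFun θ i := ⟨θ.1 i, mem_HD.1 θ.2 i⟩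
  map_add' _ _ := rfl
  map_smul' _ _ := rfl
  invFun c := ⟨fun i => (c i).1, mem_HD.2 fun i => (c i).2⟩
  left_inv _ := rfl
  right_inv _ := rfl

instance HD_fin (m : ℤ) : Module.Finite K (HD K ℓ m) := Module.Finite.equiv (HDequiv m).symm

lemma finrank_HD (m : ℤ) : Module.finrank K (HD K ℓ m) = ℓ * hS K ℓ m := by
  rw [(HDequiv m).finrank_eq, Module.finrank_pi_fintype]
  simp [hS]

def Dm (A : Finset (Submodule K (Fin ℓ → K))) (m : ℤ) : Submodule K (Deriv K ℓ) :=
  HD K ℓ m ⊓ (DS A).restrictScalars K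

lemma mem_Dm {A : Finset (Submodule K (Fin ℓ → K))} {m : ℤ} {θ : Deriv K ℓ} :
    θ ∈ Dm A m ↔ (∀ i, θ i ∈ Sh K ℓ m) ∧ InD A θ := by
  rw [Dm, Submodule.mem_inf, mem_HD]; rfl

instance Dm_fin (A : Finset (Submodule K (Fin ℓ → K))) (m : ℤ) : Module.Finite K (Dm A m) :=
  Submodule.finiteDimensional_of_le (inf_le_left : _ ≤ HD K ℓ m)

def dA (A : Finset (Submodule K (Fin ℓ → K))) (m : ℤ) : ℕ := Module.finrank K (Dm A m)

lemma dA_le (A : Finset (Submodule K (Fin ℓ → K))) (m : ℤ) : dA A m ≤ ℓ * hS K ℓ m := by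
  rw [← finrank_HD]; exact Submodule.finrank_mono inf_le_left

lemma dA_empty (m : ℤ) : dA (∅ : Finset (Submodule K (Fin ℓ → K))) m = ℓ * hS K ℓ m := by
  rw [← finrank_HD, dA]
  have : Dm (∅ : Finset (Submodule K (Fin ℓ → K))) m = HD K ℓ m := by
    ext θ; rw [mem_Dm, mem_HD]; simp [InD]
  rw [this]

def cmpD (m : ℤ) (θ : Deriv K ℓ) : Deriv K ℓ := fun i => cmp m (θ i)

lemma applyLin_cmpD (m : ℤ) (θ : Deriv K ℓ) (φ : Module.Dual K (Fin ℓ → K)) :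
    applyLin (cmpD m θ) φ = cmp m (applyLin θ φ) := by
  simp only [applyLin, cmpD, map_sum, ← smul_eq_C_mul, map_smul]

lemma cmpD_mem {A : Finset (Submodule K (Fin ℓ → K))} {θ : Deriv K ℓ} (h : InD A θ) (m : ℤ) :
    cmpD m θ ∈ Dm A m := by
  rw [mem_Dm]
  refine ⟨fun i => cmp_mem _ _, fun L hL φ hφ => ?_⟩
  rw [applyLin_cmpD]
  obtain ⟨g, hg⟩ := h L hL φ hφ
  rw [hg, cmp_mul (linPoly_mem φ)]
  exact Dvd.intro _ rfl

lemma applyLin_mem {m : ℤ} {θ : Deriv K ℓ} (h : ∀ i, θ i ∈ Sh K ℓ m)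
    (φ : Module.Dual K (Fin ℓ → K)) : applyLin θ φ ∈ Sh K ℓ m := by
  refine Submodule.sum_mem _ fun i _ => ?_
  rw [← smul_eq_C_mul]
  exact Submodule.smul_mem _ _ (h i)

/-- The ideal of values of `D(A')` at `φ`, plus `φ`. -/
def It (A : Finset (Submodule K (Fin ℓ → K))) (φ : Module.Dual K (Fin ℓ → K)) :
    Ideal (MvPolynomial (Fin ℓ) K) :=
  (DS A).map (evL φ) ⊔ Ideal.span {linPoly φ}

lemma It_hom (A : Finset (Submodule K (Fin ℓ → K))) (φ : Module.Dual K (Fin ℓ → K)) :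
    HomI (It A φ) := by
  refine HomI_sup ?_ (HomI_span (linPoly_mem φ))
  rintro x ⟨θ, hθ, rfl⟩ m
  exact ⟨cmpD m θ, (mem_Dm.1 (cmpD_mem hθ m)).2, applyLin_cmpD m θ φ⟩

lemma finrank_map_add {V W : Type*} [AddCommGroup V] [Module K V] [AddCommGroup W] [Module K W]
    (f : V →ₗ[K] W) (U : Submodule K V) [Module.Finite K U] :
    Module.finrank K (U.map f) + Module.finrank K (U ⊓ LinearMap.ker f : Submodule K V)
      = Module.finrank K U := by
  have h := (f.domRestrict U).finrank_range_add_finrank_ker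
  rw [LinearMap.range_domRestrict] at h
  rw [← h]
  congr 1
  rw [LinearMap.ker_domRestrict]
  have := Submodule.finrank_map_subtype_eq U ((LinearMap.ker f).submoduleOf U)
  rw [Submodule.submoduleOf, Submodule.map_comap_subtype] at this
  exact this

lemma drop {A : Finset (Submodule K (Fin ℓ → K))} {H : Submodule K (Fin ℓ → K)}
    (hA : IsArrangement (insert H A)) (m : ℤ) :
    dA A m + hd (Ideal.span {linPoly (frm H)}) m =
      dA (insert H A) m + hd (It A (frm H)) m := by
  have hA' : IsArrangement A := fun L hL => hA L (Finset.mem_insert_of_mem hL)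
  set φ := frm H
  set ev := (evL φ).restrictScalars K
  have e1 : Ipc (It A φ) m = (Dm A m).map ev ⊔ Ipc (Ideal.span {linPoly φ}) m := by
    ext x
    rw [mem_Ipc]
    constructor
    · rintro ⟨hx, hxI⟩
      obtain ⟨a, ⟨θ, hθ, rfl⟩, b, hb, rfl⟩ := Submodule.mem_sup.1 hxI
      rw [← cmp_same hx, map_add]
      refine Submodule.add_mem_sup ?_
        (mem_Ipc.2 ⟨cmp_mem _ _, HomI_span (linPoly_mem φ) _ hb _⟩)
      exact ⟨cmpD m θ, cmpD_mem hθ m, applyLin_cmpD m θ φ⟩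
    · intro hx
      obtain ⟨a, ⟨θ, hθ, rfl⟩, b, hb, rfl⟩ := Submodule.mem_sup.1 hx
      have hθ := mem_Dm.1 hθ
      have hb := mem_Ipc.1 hb
      exact ⟨Submodule.add_mem _ (applyLin_mem hθ.1 φ) hb.1,
        Ideal.add_mem _ (Ideal.mem_sup_left ⟨θ, hθ.2, rfl⟩) (Ideal.mem_sup_right hb.2)⟩
  have key : ∀ θ, InD (insert H A) θ ↔ InD A θ ∧ linPoly φ ∣ applyLin θ φ := by
    intro θ
    rw [InD_iff hA, InD_iff hA']
    simp only [Finset.mem_insert, forall_eq_or_imp]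
    exact and_comm
  have e2 : (Dm A m).map ev ⊓ Ipc (Ideal.span {linPoly φ}) m = (Dm (insert H A) m).map ev := by
    ext x
    constructor
    · rintro ⟨⟨θ, hθ, rfl⟩, hx⟩
      have hθ := mem_Dm.1 hθ
      exact ⟨θ, mem_Dm.2 ⟨hθ.1, (key θ).2 ⟨hθ.2, Ideal.mem_span_singleton.1 (mem_Ipc.1 hx).2⟩⟩, rfl⟩
    · rintro ⟨θ, hθ, rfl⟩
      have hθ := mem_Dm.1 hθ
      have h2 := (key θ).1 hθ.2
      exact ⟨⟨θ, mem_Dm.2 ⟨hθ.1, h2.1⟩, rfl⟩, mem_Ipc.2 ⟨applyLin_mem hθ.1 φ,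
        Ideal.mem_span_singleton.2 h2.2⟩⟩
  have e3 : Dm A m ⊓ LinearMap.ker ev = Dm (insert H A) m ⊓ LinearMap.ker ev := by
    ext θ
    simp only [Submodule.mem_inf, mem_Dm, LinearMap.mem_ker, key]
    have : ev θ = applyLin θ φ := rfl
    rw [this]
    constructor
    · rintro ⟨⟨h1, h2⟩, h3⟩; exact ⟨⟨h1, h2, by rw [h3]; exact dvd_zero _⟩, h3⟩
    · rintro ⟨⟨h1, h2, _⟩, h3⟩; exact ⟨⟨h1, h2⟩, h3⟩
  have f1 := finrank_map_add ev (Dm A m)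
  have f2 := finrank_map_add ev (Dm (insert H A) m)
  have f3 := Submodule.finrank_sup_add_finrank_inf_eq ((Dm A m).map ev)
    (Ipc (Ideal.span {linPoly φ}) m)
  rw [← e1, e2] at f3
  rw [e3] at f1
  simp only [dA, hd]
  omega

lemma summable_dA {t : ℝ} (h0 : 0 < t) (h1 : t < 1) (A : Finset (Submodule K (Fin ℓ → K))) :
    Summable fun m : ℤ => (dA A m : ℝ) * t ^ m :=
  summable_of_le (K := K) (ℓ := ℓ) h0 h1 _ ℓ (fun m => dA_le A m)

lemma HS_drop {A : Finset (Submodule K (Fin ℓ → K))} {H : Submodule K (Fin ℓ → K)}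
    (hA : IsArrangement (insert H A)) {t : ℝ} (h0 : 0 < t) (h1 : t < 1) :
    HS (dA A) t + HS (hd (Ideal.span {linPoly (frm H)})) t =
      HS (dA (insert H A)) t + HS (hd (It A (frm H))) t := by
  rw [← HS_add (summable_dA h0 h1 _) (summable_hd h0 h1 _),
    ← HS_add (summable_dA h0 h1 _) (summable_hd h0 h1 _)]
  congr 1
  funext m
  exact drop hA m

end drop

section step
variable {K : Type} [Field K] {ℓ : ℕ}

lemma hyp_le {L H : Submodule K (Fin ℓ → K)} (hL : IsHyp L) (hH : IsHyp H) (h : L ≤ H) :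
    L = H := by
  obtain ⟨c, hc⟩ := exists_smul_of_ker_le (frm L) (frm H) (by rw [frm_ker hL, frm_ker hH]; exact h)
  have c0 : c ≠ 0 := by
    rintro rfl; rw [zero_smul] at hc; exact frm_ne hH hc
  have := LinearMap.ker_smul (frm L) c c0
  rw [← hc, frm_ker hL, frm_ker hH] at this
  exact this.symm

lemma hyp_comb {L L' H : Submodule K (Fin ℓ → K)} (hL : IsHyp L) (hL' : IsHyp L') (hH : IsHyp H)
    (hne : L' ≠ H) (h : L ⊓ H ≤ L') :
    ∃ u c : K, u ≠ 0 ∧ frm L' = u • frm L + c • frm H := by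
  obtain ⟨u, c, huc⟩ := exists_comb_of_ker_le (frm L) (frm H) (frm L')
    (by rw [frm_ker hL, frm_ker hH, frm_ker hL']; exact h)
  refine ⟨u, c, ?_, huc⟩
  rintro rfl
  apply hne
  symm
  refine hyp_le hH hL' ?_
  intro v hv
  rw [← frm_ker hH, LinearMap.mem_ker] at hv
  rw [← frm_ker hL', LinearMap.mem_ker, huc]
  simp [hv]

lemma inf_le_symm {L L' H : Submodule K (Fin ℓ → K)} (hL : IsHyp L) (hL' : IsHyp L') (hH : IsHyp H)
    (hne : L' ≠ H) (h : L ⊓ H ≤ L') : L ⊓ H = L' ⊓ H := by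
  refine le_antisymm (le_inf h inf_le_right) (le_inf ?_ inf_le_right)
  obtain ⟨u, c, u0, huc⟩ := hyp_comb hL hL' hH hne h
  rintro v ⟨hv, hv2⟩
  rw [SetLike.mem_coe, ← frm_ker hH, LinearMap.mem_ker] at hv2
  rw [SetLike.mem_coe, ← frm_ker hL', LinearMap.mem_ker, huc] at hv
  rw [← frm_ker hL, LinearMap.mem_ker]
  simpa [hv2, u0] using hv

abbrev lf (L : Submodule K (Fin ℓ → K)) : MvPolynomial (Fin ℓ) K := linPoly (frm L)

lemma lf_relPrime {L L' : Submodule K (Fin ℓ → K)} (hL : IsHyp L) (hL' : IsHyp L') (h : L ≠ L') :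
    IsRelPrime (lf L) (lf L') := by
  refine linPoly_relPrime _ _ (frm_ne hL) ?_
  rw [frm_ker hL, frm_ker hL']
  exact fun hle => h (hyp_le hL hL' hle)

lemma sg_lf_ne {L H : Submodule K (Fin ℓ → K)} (hL : IsHyp L) (hH : IsHyp H) (h : L ≠ H) :
    sg H (lf L) ≠ 0 := by
  rw [Ne, sg_linPoly_eq_zero_iff, frm_ker hL]
  exact fun hle => h (hyp_le hH hL hle).symm

lemma sg_lf_relPrime {L L' H : Submodule K (Fin ℓ → K)} (hL : IsHyp L) (hL' : IsHyp L')
    (hH : IsHyp H) (hne : L ≠ H) (hne' : L' ≠ H) (h : L ⊓ H ≠ L' ⊓ H) :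
    IsRelPrime (sg H (lf L)) (sg H (lf L')) := by
  have h1 := sg_lf_ne hL hH hne
  rw [sg_linPoly] at h1
  rw [sg_linPoly, sg_linPoly]
  refine linPoly_relPrime _ _ (fun h0 => h1 (by rw [h0, linPoly_zero])) ?_
  intro hle
  apply h
  refine inf_le_symm hL hL' hH hne' ?_
  rintro v ⟨hv, hvH⟩
  have h3 : v ∈ LinearMap.ker (frm L ∘ₗ prj H) := by
    rw [LinearMap.mem_ker, LinearMap.comp_apply, prj_eq H v hvH, ← LinearMap.mem_ker, frm_ker hL]
    exact hv
  have h4 := hle h3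
  rw [LinearMap.mem_ker, LinearMap.comp_apply, prj_eq H v hvH, ← LinearMap.mem_ker,
    frm_ker hL'] at h4
  exact h4

/-- Terao's local computation. -/
lemma terao_local {A : Finset (Submodule K (Fin ℓ → K))} {H : Submodule K (Fin ℓ → K)}
    (hA : IsArrangement A) (hH : IsHyp H) (hHA : H ∉ A) (θ : Deriv K ℓ) (hθ : InD A θ)
    (L₀ : Submodule K (Fin ℓ → K)) (hL₀ : L₀ ∈ A) (F : Finset (Submodule K (Fin ℓ → K)))
    (hF : F ⊆ A) (hF2 : ∀ L ∈ F, L ⊓ H = L₀ ⊓ H) (hF3 : L₀ ∉ F) :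
    sg H (∏ L ∈ F, lf L) ∣ sg H (applyLin θ (frm H)) := by
  have hne : ∀ L ∈ A, L ≠ H := fun L hL h => hHA (h ▸ hL)
  set W := lf H * applyLin θ (frm L₀) - lf L₀ * applyLin θ (frm H) with hW
  have h1 : ∏ L ∈ insert L₀ F, lf L ∣ W := by
    have hsub : insert L₀ F ⊆ A := Finset.insert_subset hL₀ hF
    refine Finset.prod_dvd_of_isRelPrime (fun L hL L' hL' h => ?_) fun L hL => ?_
    · exact lf_relPrime (hA L (hsub hL)) (hA L' (hsub hL')) h
    · have hLA := hsub hL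
      have hLH : L ⊓ H = L₀ ⊓ H := by
        rcases Finset.mem_insert.1 hL with rfl | h
        · rfl
        · exact hF2 L h
      obtain ⟨u, c, u0, huc⟩ := hyp_comb (hA L₀ hL₀) (hA L hLA) hH (hne L hLA)
        (hLH ▸ inf_le_left)
      have hu : IsUnit (C u : MvPolynomial (Fin ℓ) K) := (isUnit_iff_ne_zero.2 u0).map C
      refine (hu.dvd_mul_left).1 ?_
      have h2 : C u * W = lf H * applyLin θ (frm L) - lf L * applyLin θ (frm H) := by
        rw [hW, lf, lf, lf, huc, applyLin_add, applyLin_smul, applyLin_smul, linPoly_add,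
          linPoly_smul, linPoly_smul]
        ring
      rw [h2]
      exact dvd_sub (Dvd.dvd.mul_left ((InD_iff hA θ).1 hθ L hLA) _) (Dvd.intro _ rfl)
  rw [Finset.prod_insert hF3] at h1
  obtain ⟨g, hg⟩ := h1
  have h3 := congrArg (sg H) hg
  rw [hW, map_sub, map_mul, map_mul, map_mul, map_mul,
    (sg_linPoly_eq_zero_iff H (frm H)).2 (frm_ker hH).ge, zero_mul, zero_sub] at h3
  refine ⟨- sg H g, ?_⟩
  refine mul_left_cancel₀ (sg_lf_ne (hA L₀ hL₀) hH (hne _ hL₀)) ?_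
  linear_combination -h3

lemma mem_It_of {A : Finset (Submodule K (Fin ℓ → K))} (hA : IsArrangement A)
    (φ : Module.Dual K (Fin ℓ → K)) (v : Fin ℓ → K) (hv : φ v ≠ 0)
    (Q : MvPolynomial (Fin ℓ) K) (hQ : ∀ L ∈ A, lf L ∣ C (frm L v) * Q) : Q ∈ It A φ := by
  have key : ∀ ψ : Module.Dual K (Fin ℓ → K),
      applyLin (fun i => C (v i) * Q) ψ = C (ψ v) * Q := by
    intro ψ
    have h : v = ∑ i, v i • Pi.single i (1:K) := by
      simpa using (pi_eq_sum_univ' v)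
    conv_rhs => rw [h, map_sum]
    simp only [applyLin, map_smul, smul_eq_mul, map_sum, Finset.sum_mul, map_mul]
    exact Finset.sum_congr rfl fun i _ => by ring
  have h1 : C (φ v) * Q ∈ It A φ := by
    refine Ideal.mem_sup_left ⟨fun i => C (v i) * Q, ?_, key φ⟩
    refine (InD_iff hA _).2 fun L hL => ?_
    rw [key]
    exact hQ L hL
  have h2 : C (φ v)⁻¹ * (C (φ v) * Q) = Q := by
    rw [← mul_assoc, ← C_mul, inv_mul_cancel₀ hv, C_1, one_mul]
  rw [← h2]
  exact Ideal.mul_mem_left _ _ h1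

lemma step {A : Finset (Submodule K (Fin ℓ → K))} {H : Submodule K (Fin ℓ → K)}
    (hAH : IsArrangement (insert H A)) (hHA : H ∉ A) :
    ∃ b r : ℕ, ∃ E : ℝ, r = (A.image (fun L => L ⊓ H)).card ∧ b + r = A.card ∧
      ∀ t : ℝ, 0 < t → t < 1 →
        HS (dA A) t - HS (dA (insert H A)) t ≤ t ^ b * (1 - t) * HS (hS K ℓ) t ∧
        (t ^ b * (1 - t) - E * (1 - t) ^ 3) * HS (hS K ℓ) t
          ≤ HS (dA A) t - HS (dA (insert H A)) t := by
  have hA : IsArrangement A := fun L hL => hAH L (Finset.mem_insert_of_mem hL)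
  have hH : IsHyp H := hAH H (Finset.mem_insert_self _ _)
  have hne : ∀ L ∈ A, L ≠ H := fun L hL h => hHA (h ▸ hL)
  set Ys := A.image (fun L => L ⊓ H) with hYs
  have hex : ∀ Y : Submodule K (Fin ℓ → K), ∃ L, Y ∈ Ys → L ∈ A ∧ L ⊓ H = Y := by
    intro Y
    by_cases h : Y ∈ Ys
    · obtain ⟨L, hL, h2⟩ := Finset.mem_image.1 h
      exact ⟨L, fun _ => ⟨hL, h2⟩⟩
    · exact ⟨⊥, fun h' => absurd h' h⟩
  choose LY hLY using hex
  set T := Ys.image LY with hT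
  have hinj : Set.InjOn LY Ys := by
    intro Y hY Y' hY' h
    rw [← (hLY Y hY).2, ← (hLY Y' hY').2, h]
  have hTA : T ⊆ A := by
    intro L hL
    obtain ⟨Y, hY, rfl⟩ := Finset.mem_image.1 hL
    exact (hLY Y hY).1
  have hTc : T.card = Ys.card := Finset.card_image_of_injOn hinj
  set B := ∏ L ∈ A \ T, lf L with hB
  set P := ∏ Y ∈ Ys, lf (LY Y) with hP
  have hBP : B * P = ∏ L ∈ A, lf L := by
    rw [hP, ← Finset.prod_image (f := fun L => lf L) hinj, ← hT, hB, Finset.prod_sdiff hTA]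
  have hBdeg : B ∈ Sh K ℓ ((A \ T).card : ℤ) := prod_mem _ _ fun L _ => linPoly_mem _
  have hBs : sg H B ≠ 0 := by
    rw [hB, map_prod, Finset.prod_ne_zero_iff]
    intro L hL
    have := (Finset.mem_sdiff.1 hL).1
    exact sg_lf_ne (hA L this) hH (hne L this)
  have hB0 : B ≠ 0 := by
    intro h; rw [h, map_zero] at hBs; exact hBs rfl
  have hter : It A (frm H) ≤ Ideal.span {lf H} ⊔ Ideal.span {B} := by
    refine sup_le ?_ le_sup_left
    rintro x ⟨θ, hθ, rfl⟩
    refine mem_sup_of_sg_dvd (frm H) B _ ?_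
    rw [frm_ker hH]
    have hmaps : ∀ L ∈ A \ T, L ⊓ H ∈ Ys := fun L hL =>
      Finset.mem_image_of_mem _ (Finset.mem_sdiff.1 hL).1
    rw [hB, ← Finset.prod_fiberwise_of_maps_to hmaps, map_prod]
    refine Finset.prod_dvd_of_isRelPrime (fun Y hY Y' hY' h => ?_) fun Y hY => ?_
    · simp only [Function.onFun, map_prod]
      refine IsRelPrime.prod_left fun L hL => IsRelPrime.prod_right fun L' hL' => ?_
      simp only [Finset.mem_filter, Finset.mem_sdiff] at hL hL'
      refine sg_lf_relPrime (hA L hL.1.1) (hA L' hL'.1.1) hH (hne _ hL.1.1) (hne _ hL'.1.1) ?_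
      rw [hL.2, hL'.2]; exact h
    · refine terao_local hA hH hHA θ hθ (LY Y) (hLY Y hY).1 _ ?_ ?_ ?_
      · intro L hL
        simp only [Finset.mem_filter, Finset.mem_sdiff] at hL
        exact hL.1.1
      · intro L hL
        simp only [Finset.mem_filter] at hL
        rw [hL.2, (hLY Y hY).2]
      · intro h
        simp only [Finset.mem_filter, Finset.mem_sdiff] at h
        exact h.1.2 (Finset.mem_image_of_mem _ hY)
  -- the lower bound elements
  have hlow : ∀ Y ∈ Ys, B * ∏ Y' ∈ Ys.erase Y, lf (LY Y') ∈ It A (frm H) := by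
    intro Y hY
    have hL := (hLY Y hY).1
    have h1 : B * ∏ Y' ∈ Ys.erase Y, lf (LY Y') = ∏ L ∈ A.erase (LY Y), lf L := by
      refine mul_left_cancel₀ (linPoly_prime _ (frm_ne (hA _ hL))).ne_zero ?_
      rw [Finset.mul_prod_erase A (fun L => lf L) hL, ← hBP, hP,
        ← Finset.mul_prod_erase Ys (fun Y => lf (LY Y)) hY]
      ring
    rw [h1]
    have h2 : ¬ LY Y ≤ H := fun h => hne _ hL (hyp_le (hA _ hL) hH h)
    obtain ⟨v, hv, hvH⟩ := SetLike.not_le_iff_exists.1 h2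
    refine mem_It_of hA (frm H) v ?_ _ fun L hLA => ?_
    · rw [← frm_ker hH, LinearMap.mem_ker] at hvH; exact hvH
    · by_cases hLL : L = LY Y
      · have : frm L v = 0 := by
          rw [← LinearMap.mem_ker, frm_ker (hA L hLA), hLL]; exact hv
        rw [this, C_0, zero_mul]; exact dvd_zero _
      · exact Dvd.dvd.mul_left (Finset.dvd_prod_of_mem _ (Finset.mem_erase.2 ⟨hLL, hLA⟩)) _
  have hfull : B * P ∈ It A (frm H) := by
    rw [hBP]
    obtain ⟨v, hv⟩ : ∃ v, frm H v ≠ 0 := by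
      by_contra h
      push Not at h
      exact frm_ne hH (LinearMap.ext h)
    exact mem_It_of hA (frm H) v hv _ fun L hLA =>
      Dvd.dvd.mul_left (Finset.dvd_prod_of_mem _ hLA) _
  refine ⟨(A \ T).card, Ys.card, (Ys.card : ℝ) * Ys.card, rfl, ?_, ?_⟩
  · rw [← hTc]; exact Finset.card_sdiff_add_card_eq_card hTA
  intro t h0 h1
  have hpos := HS_hS_pos (K := K) (ℓ := ℓ) h0 h1
  have hdrop := HS_drop hAH h0 h1
  have hlin := HS_lin h0 h1 (frm H) (frm_ne hH)
  have hndB : ¬ linPoly (frm H) ∣ B := by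
    rw [dvd_iff_sg, frm_ker hH]; exact hBs
  have hlB := HS_lin_sup h0 h1 (frm H) (frm_ne hH) hBdeg hndB
  have hup : HS (hd (It A (frm H))) t ≤ HS (hd (Ideal.span {lf H} ⊔ Ideal.span {B})) t :=
    HS_mono h0 (summable_hd h0 h1 _) (summable_hd h0 h1 _) (fun m => hd_mono hter m)
  -- filtration
  have hfil : ∀ Z ⊆ Ys, HS (hd (Ideal.span {lf H} ⊔ Ideal.span {B})) t ≤
      HS (hd (It A (frm H) ⊔ Ideal.span {B * ∏ Y ∈ Z, lf (LY Y)})) t +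
        Z.card * ((1 - t ^ (Ys.card - 1)) * ((1 - t) * ((1 - t) * HS (hS K ℓ) t))) := by
    intro Z
    induction Z using Finset.induction_on with
    | empty =>
      intro _
      have : Ideal.span {lf H} ⊔ Ideal.span {B} ≤
          It A (frm H) ⊔ Ideal.span {B * ∏ Y ∈ (∅ : Finset (Submodule K (Fin ℓ → K))), lf (LY Y)} := by
        rw [Finset.prod_empty, mul_one]
        exact sup_le_sup_right le_sup_right _
      simpa using HS_mono h0 (summable_hd h0 h1 _) (summable_hd h0 h1 _) (fun m => hd_mono this m)
    | insert Y Z hYZ ih =>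
      intro hsub
      have hY : Y ∈ Ys := hsub (Finset.mem_insert_self _ _)
      have hZ : Z ⊆ Ys := fun y hy => hsub (Finset.mem_insert_of_mem hy)
      refine (ih hZ).trans ?_
      set f := B * ∏ Y ∈ Z, lf (LY Y) with hf
      rw [Finset.prod_insert hYZ, Finset.card_insert_of_notMem hYZ]
      have hfY : B * (lf (LY Y) * ∏ Y ∈ Z, lf (LY Y)) = f * lf (LY Y) := by rw [hf]; ring
      rw [hfY]
      have hfdeg : f ∈ Sh K ℓ (((A \ T).card + Z.card : ℕ) : ℤ) := by
        push_cast
        exact Sh_mul hBdeg (prod_mem _ _ fun Y _ => linPoly_mem _)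
      have hf0 : f ≠ 0 := by
        rw [hf]
        refine mul_ne_zero hB0 (Finset.prod_ne_zero_iff.2 fun Y hY => ?_)
        exact (linPoly_prime _ (frm_ne (hA _ (hLY Y (hZ hY)).1))).ne_zero
      set I := It A (frm H) ⊔ Ideal.span {f * lf (LY Y)} with hI
      set g := ∏ Y' ∈ Ys.erase Y, lf (LY Y') with hg
      set J := Ideal.span {lf H} ⊔ Ideal.span {lf (LY Y)} ⊔ Ideal.span {g} with hJ
      have hIhom : HomI I := HomI_sup (It_hom A _) (HomI_span (Sh_mul hfdeg (linPoly_mem _)))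
      have hgdeg : g ∈ Sh K ℓ ((Ys.card - 1 : ℕ) : ℤ) := by
        rw [← Finset.card_erase_of_mem hY]
        exact prod_mem _ _ fun Y _ => linPoly_mem _
      have hJI : ∀ x ∈ J, f * x ∈ I := by
        have : J ≤ coln I f := by
          rw [hJ, sup_le_iff, sup_le_iff, Ideal.span_singleton_le_iff_mem,
            Ideal.span_singleton_le_iff_mem, Ideal.span_singleton_le_iff_mem, mem_coln, mem_coln,
            mem_coln]
          refine ⟨⟨?_, ?_⟩, ?_⟩
          · exact Ideal.mem_sup_left (Ideal.mul_mem_left _ _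
              (Ideal.mem_sup_right (Ideal.mem_span_singleton_self _)))
          · exact Ideal.mem_sup_right (Ideal.mem_span_singleton_self _)
          · refine Ideal.mem_sup_left ?_
            have : f * g = (∏ Y ∈ Z, lf (LY Y)) * (B * g) := by rw [hf]; ring
            rw [this]
            exact Ideal.mul_mem_left _ _ (hlow Y hY)
        exact fun x hx => mem_coln.1 (this hx)
      have hle := HS_sup_le h0 h1 I J hIhom hfdeg hf0 hJI
      have hLH : ¬ LinearMap.ker (frm H) ≤ LinearMap.ker (frm (LY Y)) := by
        have hL := (hLY Y hY).1
        rw [frm_ker hH, frm_ker (hA _ hL)]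
        exact fun h => hne _ hL (hyp_le hH (hA _ hL) h).symm
      have hgs : sg (LinearMap.ker (frm H) ⊓ LinearMap.ker (frm (LY Y))) g ≠ 0 := by
        rw [hg, map_prod, Finset.prod_ne_zero_iff]
        intro Y' hY'
        obtain ⟨hne', hY'⟩ := Finset.mem_erase.1 hY'
        have hL := (hLY Y hY)
        have hL' := (hLY Y' hY')
        rw [Ne, sg_linPoly_eq_zero_iff, frm_ker hH, frm_ker (hA _ hL.1), frm_ker (hA _ hL'.1)]
        intro h
        apply hne'
        rw [← hL.2, ← hL'.2]
        exact (inf_le_symm (hA _ hL.1) (hA _ hL'.1) hH (hne _ hL'.1) (by rwa [inf_comm])).symm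
      have hpair := HS_pair_sup h0 h1 (frm H) (frm (LY Y)) (frm_ne hH) hLH hgdeg hgs
      have hmono : HS (hd (It A (frm H) ⊔ Ideal.span {f})) t ≤ HS (hd (I ⊔ Ideal.span {f})) t :=
        HS_mono h0 (summable_hd h0 h1 _) (summable_hd h0 h1 _)
          (fun m => hd_mono (sup_le_sup_right le_sup_left _) m)
      rw [hpair] at hle
      push_cast
      linarith
  have hfin := hfil Ys le_rfl
  have heq : It A (frm H) ⊔ Ideal.span {B * ∏ Y ∈ Ys, lf (LY Y)} = It A (frm H) := by
    rw [sup_eq_left, Ideal.span_singleton_le_iff_mem]; exact hfull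
  rw [heq] at hfin
  have hbern : 1 - t ^ (Ys.card - 1) ≤ Ys.card * (1 - t) := by
    have h2 := one_add_mul_le_pow (a := t - 1) (by linarith) (Ys.card - 1)
    have h3 : ((Ys.card - 1 : ℕ) : ℝ) ≤ Ys.card := by exact_mod_cast Nat.sub_le _ _
    rw [add_sub_cancel] at h2
    nlinarith
  have hb2 : (Ys.card : ℝ) * ((1 - t ^ (Ys.card - 1)) * ((1 - t) * ((1 - t) * HS (hS K ℓ) t))) ≤
      (Ys.card : ℝ) * ((Ys.card * (1 - t)) * ((1 - t) * ((1 - t) * HS (hS K ℓ) t))) := by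
    have : 0 ≤ 1 - t := by linarith
    gcongr
  constructor
  · linear_combination hup + hdrop - hlB + hlin
  · linear_combination hfin + hb2 - hdrop + hlB - hlin

end step

section pog
variable {K : Type} [Field K] {ℓ : ℕ}

def Fmap (θ : Fin ℓ → Deriv K ℓ) (φ : Deriv K ℓ) :
    ((Fin ℓ → MvPolynomial (Fin ℓ) K) × MvPolynomial (Fin ℓ) K) →ₗ[K] Deriv K ℓ where
  toFun x := (∑ i, x.1 i • θ i) + x.2 • φ
  map_add' x y := by
    simp only [Prod.fst_add, Prod.snd_add, Pi.add_apply, add_smul, Finset.sum_add_distrib]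
    abel
  map_smul' c x := by
    simp only [Prod.smul_fst, Prod.smul_snd, Pi.smul_apply, smul_assoc, RingHom.id_apply,
      smul_add, Finset.smul_sum]

def Gmap (f : Fin ℓ → MvPolynomial (Fin ℓ) K) (α : MvPolynomial (Fin ℓ) K) :
    MvPolynomial (Fin ℓ) K →ₗ[K] ((Fin ℓ → MvPolynomial (Fin ℓ) K) × MvPolynomial (Fin ℓ) K) where
  toFun q := (fun i => f i * q, α * q)
  map_add' x y := by
    ext <;> simp [mul_add]
  map_smul' c x := by
    ext <;> simp

def UU (K : Type) [Field K] {ℓ : ℕ} (e : Fin ℓ → ℕ) (lev : ℕ) (m : ℤ) :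
    Submodule K ((Fin ℓ → MvPolynomial (Fin ℓ) K) × MvPolynomial (Fin ℓ) K) :=
  (Submodule.pi Set.univ fun i => Sh K ℓ (m - e i)).prod (Sh K ℓ (m - lev))

lemma mem_UU {e : Fin ℓ → ℕ} {lev : ℕ} {m : ℤ} {x} :
    x ∈ UU K e lev m ↔ (∀ i, x.1 i ∈ Sh K ℓ (m - e i)) ∧ x.2 ∈ Sh K ℓ (m - lev) := by
  simp [UU, Submodule.mem_prod]

def UUequiv (e : Fin ℓ → ℕ) (lev : ℕ) (m : ℤ) :
    UU K e lev m ≃ₗ[K] ((i : Fin ℓ) → Sh K ℓ (m - e i)) × Sh K ℓ (m - lev) where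
  toFun x := (fun i => ⟨x.1.1 i, (mem_UU.1 x.2).1 i⟩, ⟨x.1.2, (mem_UU.1 x.2).2⟩)
  map_add' _ _ := rfl
  map_smul' _ _ := rfl
  invFun c := ⟨(fun i => (c.1 i).1, c.2.1), mem_UU.2 ⟨fun i => (c.1 i).2, c.2.2⟩⟩
  left_inv _ := rfl
  right_inv _ := rfl

instance UU_fin (e : Fin ℓ → ℕ) (lev : ℕ) (m : ℤ) : Module.Finite K (UU K e lev m) :=
  Module.Finite.equiv (UUequiv e lev m).symm

lemma finrank_UU (e : Fin ℓ → ℕ) (lev : ℕ) (m : ℤ) :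
    Module.finrank K (UU K e lev m) = ∑ i, hS K ℓ (m - e i) + hS K ℓ (m - lev) := by
  rw [(UUequiv e lev m).finrank_eq, Module.finrank_prod, Module.finrank_pi_fintype]
  rfl

lemma pog_dim {A : Finset (Submodule K (Fin ℓ → K))} {e : Fin ℓ → ℕ} {lev : ℕ}
    (hpog : IsPOG A e lev) (m : ℤ) :
    dA A m + hS K ℓ (m - (lev + 1 : ℕ)) = ∑ i, hS K ℓ (m - e i) + hS K ℓ (m - lev) := by
  obtain ⟨θ, φ, f, α, hθ, hφ, hθd, hφd, hgen, hα, hf, hf0, hrel, hnz, hsyz⟩ := hpog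
  have hθS : ∀ i j, θ i j ∈ Sh K ℓ (e i) := fun i j => Sh_of_homog (hθd i j)
  have hφS : ∀ j, φ j ∈ Sh K ℓ lev := fun j => Sh_of_homog (hφd j)
  have hαS : α ∈ Sh K ℓ 1 := by exact_mod_cast Sh_of_homog hα
  have hfS : ∀ i, f i ∈ Sh K ℓ ((lev : ℤ) + 1 - e i) := by
    intro i
    by_cases h : e i ≤ lev + 1
    · have := Sh_of_homog (hf i)
      rw [Nat.cast_sub h] at this
      exact_mod_cast this
    · have h0 : lev + 1 - e i = 0 := by omega
      have h1 := hf i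
      rw [h0] at h1
      have h2 : f i = 0 := by
        rw [(totalDegree_eq_zero_iff_eq_C (p := f i)).1 (by
          by_cases hz : f i = 0
          · simp [hz]
          · exact h1.totalDegree hz)]
        have := hf0 i
        rw [constantCoeff_eq] at this
        rw [this, C_0]
      rw [h2]; exact Submodule.zero_mem _
  have hmap : (UU K e lev m).map (Fmap θ φ) = Dm A m := by
    apply le_antisymm
    · rintro _ ⟨⟨c, g⟩, hx, rfl⟩
      obtain ⟨hc, hg⟩ := mem_UU.1 hx
      rw [mem_Dm]
      refine ⟨fun j => ?_, ?_⟩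
      · change ((∑ i, c i • θ i) + g • φ) j ∈ _
        rw [Pi.add_apply, Finset.sum_apply]
        refine Submodule.add_mem _ (Submodule.sum_mem _ fun i _ => ?_) ?_
        · have := Sh_mul (hc i) (hθS i j)
          simpa using this
        · have := Sh_mul hg (hφS j)
          simpa using this
      · change _ ∈ DS A
        exact Submodule.add_mem _ (Submodule.sum_mem _ fun i _ => Submodule.smul_mem _ _ (hθ i))
          (Submodule.smul_mem _ _ hφ)
    · intro η hη
      obtain ⟨h1, h2⟩ := mem_Dm.1 hη
      obtain ⟨c, g, hcg⟩ := hgen η h2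
      refine ⟨(fun i => cmp (m - e i) (c i), cmp (m - lev) g),
        mem_UU.2 ⟨fun i => cmp_mem _ _, cmp_mem _ _⟩, ?_⟩
      funext j
      change ((∑ i, cmp (m - e i) (c i) • θ i) + cmp (m - lev) g • φ) j = η j
      rw [← cmp_same (h1 j), hcg]
      simp only [Pi.add_apply, Finset.sum_apply, Pi.smul_apply, smul_eq_mul, map_add, map_sum]
      congr 1
      · refine Finset.sum_congr rfl fun i _ => ?_
        rw [mul_comm (c i), cmp_mul (hθS i j), mul_comm]
      · rw [mul_comm g, cmp_mul (hφS j), mul_comm]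
  have hker : UU K e lev m ⊓ LinearMap.ker (Fmap θ φ) =
      (Sh K ℓ (m - (lev + 1 : ℕ))).map (Gmap f α) := by
    apply le_antisymm
    · rintro ⟨c, g⟩ ⟨hx, hk⟩
      obtain ⟨hc, hg⟩ := mem_UU.1 hx
      obtain ⟨q, hq, hq2⟩ := hsyz c g hk
      refine ⟨cmp (m - (lev + 1 : ℕ)) q, cmp_mem _ _, ?_⟩
      change ((fun i => f i * cmp (m - (lev + 1 : ℕ)) q), α * cmp (m - (lev + 1 : ℕ)) q) = (c, g)
      refine Prod.ext (funext fun i => ?_) ?_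
      · change f i * _ = c i
        have hci : c i ∈ _ := hc i
        rw [← cmp_same hci, hq i, mul_comm q, cmp_mul (hfS i)]
        congr 3; push_cast; ring
      · change α * _ = g
        change g ∈ _ at hg
        rw [← cmp_same hg, hq2, mul_comm q, cmp_mul hαS]
        congr 3; push_cast; ring
    · rintro _ ⟨q, hq, rfl⟩
      refine ⟨mem_UU.2 ⟨fun i => ?_, ?_⟩, ?_⟩
      · have := Sh_mul (hfS i) hq
        change f i * q ∈ _
        convert this using 2; push_cast; ring
      · have := Sh_mul hαS hq
        change α * q ∈ _
        convert this using 2; push_cast; ring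
      · change (∑ i, (f i * q) • θ i) + (α * q) • φ = 0
        have : (∑ i, (f i * q) • θ i) + (α * q) • φ = q • ((∑ i, f i • θ i) + α • φ) := by
          rw [smul_add, Finset.smul_sum, smul_smul, mul_comm α]
          congr 1
          exact Finset.sum_congr rfl fun i _ => by rw [smul_smul, mul_comm]
        rw [this, hrel, smul_zero]
  have hinj : Function.Injective (Gmap f α) := by
    rw [← LinearMap.ker_eq_bot, eq_bot_iff]
    intro q hq
    rw [Submodule.mem_bot]
    have h : ((fun i => f i * q), α * q) = (0 : (Fin ℓ → MvPolynomial (Fin ℓ) K) × MvPolynomial (Fin ℓ) K) := hq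
    by_contra q0
    apply hnz
    constructor
    · have := congrArg Prod.snd h
      simpa [q0] using this
    · intro i
      have := congrFun (congrArg Prod.fst h) i
      simpa [q0] using this
  have h := finrank_map_add (Fmap θ φ) (UU K e lev m)
  rw [hmap, hker, ← (Submodule.equivMapOfInjective _ hinj _).finrank_eq, finrank_UU] at h
  exact h

lemma HS_sum {ι : Type*} {t : ℝ} (s : Finset ι) (a : ι → ℤ → ℕ)
    (ha : ∀ i ∈ s, Summable fun m : ℤ => (a i m : ℝ) * t ^ m) :
    HS (fun m => ∑ i ∈ s, a i m) t = ∑ i ∈ s, HS (a i) t := by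
  unfold HS
  rw [← Summable.tsum_finsetSum ha]
  congr 1; funext m; push_cast; rw [Finset.sum_mul]

lemma summable_sum' {ι : Type*} {t : ℝ} (s : Finset ι) (a : ι → ℤ → ℕ)
    (ha : ∀ i ∈ s, Summable fun m : ℤ => (a i m : ℝ) * t ^ m) :
    Summable fun m : ℤ => ((∑ i ∈ s, a i m : ℕ) : ℝ) * t ^ m := by
  have := summable_sum ha
  convert this using 2
  push_cast; rw [Finset.sum_mul]

lemma pog_HS {A : Finset (Submodule K (Fin ℓ → K))} {e : Fin ℓ → ℕ} {lev : ℕ}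
    (hpog : IsPOG A e lev) {t : ℝ} (h0 : 0 < t) (h1 : t < 1) :
    HS (dA A) t = (∑ i, t ^ e i + t ^ lev - t ^ (lev + 1)) * HS (hS K ℓ) t := by
  have hs : ∀ d : ℕ, Summable fun m : ℤ => (hS K ℓ (m - d) : ℝ) * t ^ m := fun d =>
    summable_shift h0 _ d (summable_hS h0 h1)
  have h := HS_add (t := t) (summable_dA h0 h1 A) (hs (lev + 1))
  have h2 := HS_add (t := t) (summable_sum' Finset.univ (fun i m => hS K ℓ (m - e i))
    fun i _ => hs (e i)) (hs lev)
  rw [funext (pog_dim hpog), h2, HS_sum _ _ (fun i _ => hs (e i))] at h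
  simp only [HS_shift h0] at h
  rw [← Finset.sum_mul] at h
  linarith

end pog

section comb
variable {K : Type} [Field K] {ℓ : ℕ}

def fl (A : Finset (Submodule K (Fin ℓ → K))) : Finset (Submodule K (Fin ℓ → K)) :=
  A.offDiag.image (fun p => p.1 ⊓ p.2)

lemma mem_fl {A : Finset (Submodule K (Fin ℓ → K))} {X : Submodule K (Fin ℓ → K)} :
    X ∈ fl A ↔ ∃ L ∈ A, ∃ L' ∈ A, L ≠ L' ∧ L ⊓ L' = X := by
  simp only [fl, Finset.mem_image, Finset.mem_offDiag, Prod.exists]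
  constructor
  · rintro ⟨a, b, ⟨h1, h2, h3⟩, h4⟩; exact ⟨a, h1, b, h2, h3, h4⟩
  · rintro ⟨a, h1, b, h2, h3, h4⟩; exact ⟨a, b, ⟨h1, h2, h3⟩, h4⟩

def b2 (A : Finset (Submodule K (Fin ℓ → K))) : ℤ :=
  ∑ X ∈ fl A, (((localize A X).card : ℤ) - 1)

lemma b2_empty : b2 (∅ : Finset (Submodule K (Fin ℓ → K))) = 0 := by simp [b2, fl]

lemma b2_insert {A : Finset (Submodule K (Fin ℓ → K))} {H : Submodule K (Fin ℓ → K)}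
    (hAH : IsArrangement (insert H A)) (hHA : H ∉ A) :
    b2 (insert H A) = b2 A + ((A.image (fun L => L ⊓ H)).card : ℤ) := by
  have hH : IsHyp H := hAH H (Finset.mem_insert_self _ _)
  have hA : ∀ L ∈ A, IsHyp L := fun L hL => hAH L (Finset.mem_insert_of_mem hL)
  have hne : ∀ L ∈ A, L ≠ H := fun L hL h => hHA (h ▸ hL)
  set Ys := A.image (fun L => L ⊓ H) with hYs
  have hfl : fl (insert H A) = fl A ∪ (Ys \ fl A) := by
    rw [Finset.union_sdiff_self_eq_union]
    ext X
    rw [Finset.mem_union, mem_fl, mem_fl, hYs, Finset.mem_image]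
    constructor
    · rintro ⟨L, hL, L', hL', hn, rfl⟩
      rcases Finset.mem_insert.1 hL with hL1 | hL1
      · rcases Finset.mem_insert.1 hL' with hL2 | hL2
        · exact absurd (hL1.trans hL2.symm) hn
        · exact Or.inr ⟨L', hL2, by rw [hL1, inf_comm]⟩
      · rcases Finset.mem_insert.1 hL' with hL2 | hL2
        · exact Or.inr ⟨L, hL1, by rw [hL2]⟩
        · exact Or.inl ⟨L, hL1, L', hL2, hn, rfl⟩
    · rintro (⟨L, hL, L', hL', hn, rfl⟩ | ⟨L, hL, rfl⟩)
      · exact ⟨L, Finset.mem_insert_of_mem hL, L', Finset.mem_insert_of_mem hL', hn, rfl⟩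
      · exact ⟨L, Finset.mem_insert_of_mem hL, H, Finset.mem_insert_self _ _, hne L hL, rfl⟩
  have h1 : ∀ X ∈ fl A, (((localize (insert H A) X).card : ℤ) - 1) =
      (((localize A X).card : ℤ) - 1) + (if X ∈ Ys then 1 else 0) := by
    intro X hX
    have hiff : X ∈ Ys ↔ X ≤ H := by
      constructor
      · intro h
        obtain ⟨L, hL, rfl⟩ := Finset.mem_image.1 h
        exact inf_le_right
      · intro h
        obtain ⟨L, hL, L', hL', hn, rfl⟩ := mem_fl.1 hX
        refine Finset.mem_image.2 ⟨L', hL', ?_⟩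
        rw [inf_le_symm (hA L hL) hH (hA L' hL') (hne L' hL').symm h, inf_comm]
    unfold localize
    rw [Finset.filter_insert]
    by_cases h : X ≤ H
    · rw [if_pos h, if_pos (hiff.2 h), Finset.card_insert_of_notMem (by simp [hHA])]
      push_cast; ring
    · rw [if_neg h, if_neg (fun h' => h (hiff.1 h'))]; ring
  have h2 : ∀ X ∈ Ys \ fl A, (((localize (insert H A) X).card : ℤ) - 1) = 1 := by
    intro X hX
    rw [Finset.mem_sdiff] at hX
    obtain ⟨hX1, hX2⟩ := hX
    obtain ⟨L, hL, rfl⟩ := Finset.mem_image.1 hX1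
    have : localize (insert H A) (L ⊓ H) = {L, H} := by
      ext M
      simp only [localize, Finset.mem_filter, Finset.mem_insert, Finset.mem_singleton]
      constructor
      · rintro ⟨rfl | hM, hle⟩
        · exact Or.inr rfl
        · left
          by_contra hML
          apply hX2
          refine mem_fl.2 ⟨M, hM, L, hL, hML, ?_⟩
          rw [inf_comm L H]
          exact (inf_le_symm hH (hA M hM) (hA L hL) hML (by rwa [inf_comm])).symm
      · rintro (rfl | rfl)
        · exact ⟨Or.inr hL, inf_le_left⟩
        · exact ⟨Or.inl rfl, inf_le_right⟩
    rw [this, Finset.card_pair (hne L hL)]; norm_num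
  unfold b2
  rw [hfl, Finset.sum_union Finset.disjoint_sdiff, Finset.sum_congr rfl h1, Finset.sum_congr rfl h2,
    Finset.sum_add_distrib, add_assoc]
  congr 1
  rw [← Finset.card_sdiff_add_card_inter Ys (fl A)]
  simp only [Finset.sum_const, Finset.sum_boole, nsmul_eq_mul, mul_one, Nat.cast_add]
  rw [Finset.filter_mem_eq_inter, Finset.inter_comm, add_comm]

lemma hyp_finrank {L : Submodule K (Fin ℓ → K)} (hL : IsHyp L) : Module.finrank K L + 1 = ℓ := by
  obtain ⟨φ, h0, rfl⟩ := hL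
  have := Module.Dual.finrank_ker_add_one_of_ne_zero h0
  simpa using this

lemma inf_finrank {L L' : Submodule K (Fin ℓ → K)} (hL : IsHyp L) (hL' : IsHyp L') (h : L ≠ L') :
    Module.finrank K (L ⊓ L' : Submodule K (Fin ℓ → K)) + 2 = ℓ := by
  have h1 := Submodule.finrank_sup_add_finrank_inf_eq L L'
  have h2 : L < L ⊔ L' := lt_of_le_of_ne le_sup_left
    (fun h3 => h (hyp_le hL' hL (h3 ▸ le_sup_right)).symm)
  have h3 := Submodule.finrank_lt_finrank_of_lt h2
  have h4 := Submodule.finrank_le (L ⊔ L')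
  rw [Module.finrank_fin_fun] at h4
  have := hyp_finrank hL
  have := hyp_finrank hL'
  omega

lemma lat_cases {A : Finset (Submodule K (Fin ℓ → K))} {X : Submodule K (Fin ℓ → K)}
    (hX : X ∈ latticeOf ⊤ A) :
    X = ⊤ ∨ X ∈ A ∨ ∃ L ∈ A, ∃ L' ∈ A, L ≠ L' ∧ X ≤ L ⊓ L' := by
  simp only [latticeOf, Finset.mem_image, Finset.mem_powerset, top_inf_eq] at hX
  obtain ⟨B, hB, rfl⟩ := hX
  rcases B.eq_empty_or_nonempty with rfl | ⟨L, hL⟩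
  · left; simp
  · right
    by_cases h : ∃ L' ∈ B, L ≠ L'
    · obtain ⟨L', hL', hn⟩ := h
      exact Or.inr ⟨L, hB hL, L', hB hL', hn,
        le_inf (Finset.inf_le (f := id) hL) (Finset.inf_le (f := id) hL')⟩
    · left
      push Not at h
      have : B = {L} := by
        ext M; rw [Finset.mem_singleton]
        exact ⟨fun hM => (h M hM).symm, fun hM => hM ▸ hL⟩
      rw [this, Finset.inf_singleton]; exact hB hL

lemma top_mem_lat {A : Finset (Submodule K (Fin ℓ → K))} : ⊤ ∈ latticeOf ⊤ A := by
  simp only [latticeOf, Finset.mem_image, Finset.mem_powerset, top_inf_eq]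
  exact ⟨∅, by simp, by simp⟩

lemma mem_lat {A : Finset (Submodule K (Fin ℓ → K))} {L : Submodule K (Fin ℓ → K)} (h : L ∈ A) :
    L ∈ latticeOf ⊤ A := by
  simp only [latticeOf, Finset.mem_image, Finset.mem_powerset, top_inf_eq]
  exact ⟨{L}, by simpa using h, by simp⟩

lemma fl_mem_lat {A : Finset (Submodule K (Fin ℓ → K))} {X : Submodule K (Fin ℓ → K)}
    (h : X ∈ fl A) : X ∈ latticeOf ⊤ A := by
  obtain ⟨L, hL, L', hL', -, rfl⟩ := mem_fl.1 h
  simp only [latticeOf, Finset.mem_image, Finset.mem_powerset, top_inf_eq]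
  exact ⟨{L, L'}, by intro M; simp only [Finset.mem_insert, Finset.mem_singleton]
                     rintro (rfl | rfl) <;> assumption, by simp⟩

lemma mob_top (Lt : Finset (Submodule K (Fin ℓ → K))) : mob ⊤ Lt ⊤ = 1 := by
  rw [mob]; simp

lemma mob_ne (Lt : Finset (Submodule K (Fin ℓ → K))) {X : Submodule K (Fin ℓ → K)} (h : X ≠ ⊤) :
    mob ⊤ Lt X = - ∑ Y ∈ Lt.filter (fun Z => X < Z), mob ⊤ Lt Y := by
  rw [mob, if_neg h, Finset.sum_attach _ (fun Y => mob ⊤ Lt Y)]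

lemma hyp_ne_top {L : Submodule K (Fin ℓ → K)} (hL : IsHyp L) : L ≠ ⊤ := by
  rintro rfl
  have := hyp_finrank hL
  rw [finrank_top, Module.finrank_fin_fun] at this
  omega

lemma mob_hyp {A : Finset (Submodule K (Fin ℓ → K))} (hA : IsArrangement A)
    {L : Submodule K (Fin ℓ → K)} (hL : L ∈ A) : mob ⊤ (latticeOf ⊤ A) L = -1 := by
  have hL' : IsHyp L := hA L hL
  rw [mob_ne _ (hyp_ne_top hL')]
  have : (latticeOf ⊤ A).filter (fun Z => L < Z) = {⊤} := by
    ext Z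
    rw [Finset.mem_filter, Finset.mem_singleton]
    constructor
    · rintro ⟨h1, h2⟩
      rcases lat_cases h1 with h | h | ⟨M, hM, M', hM', hn, h⟩
      · exact h
      · exact absurd (hyp_le hL' (hA Z h) h2.le) h2.ne
      · exact absurd (hyp_le hL' (hA M hM) (h2.le.trans (h.trans inf_le_left)))
          (h2.trans_le (h.trans inf_le_left)).ne
    · rintro rfl
      exact ⟨top_mem_lat, lt_top_iff_ne_top.2 (hyp_ne_top hL')⟩
  rw [this, Finset.sum_singleton, mob_top]

lemma mob_fl {A : Finset (Submodule K (Fin ℓ → K))} (hA : IsArrangement A)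
    {X : Submodule K (Fin ℓ → K)} (hX : X ∈ fl A) :
    mob ⊤ (latticeOf ⊤ A) X = ((localize A X).card : ℤ) - 1 := by
  obtain ⟨L, hL, L', hL', hn, rfl⟩ := mem_fl.1 hX
  have hr := inf_finrank (hA L hL) (hA L' hL') hn
  have htop : L ⊓ L' ≠ ⊤ := by
    intro h
    exact hyp_ne_top (hA L hL) (eq_top_iff.2 (h ▸ inf_le_left))
  rw [mob_ne _ htop]
  have : (latticeOf ⊤ A).filter (fun Z => L ⊓ L' < Z) = insert ⊤ (localize A (L ⊓ L')) := by
    ext Z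
    simp only [Finset.mem_filter, Finset.mem_insert, localize]
    constructor
    · rintro ⟨h1, h2⟩
      rcases lat_cases h1 with h | h | ⟨M, hM, M', hM', hn', h⟩
      · exact Or.inl h
      · exact Or.inr ⟨h, h2.le⟩
      · exfalso
        have h3 := inf_finrank (hA M hM) (hA M' hM') hn'
        have h4 := Submodule.finrank_lt_finrank_of_lt (h2.trans_le h)
        omega
    · rintro (rfl | ⟨h1, h2⟩)
      · exact ⟨top_mem_lat, lt_top_iff_ne_top.2 htop⟩
      · refine ⟨mem_lat h1, lt_of_le_of_ne h2 fun h => ?_⟩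
        have := hyp_finrank (hA Z h1)
        rw [← h] at this
        omega
  rw [this, Finset.sum_insert, mob_top, Finset.sum_congr (s₁ := localize A (L ⊓ L')) rfl
    (fun Y hY => mob_hyp hA (Finset.mem_filter.1 hY).1)]
  · simp; ring
  · intro h
    exact hyp_ne_top (hA _ (Finset.mem_filter.1 h).1) rfl

lemma coeff_char (A : Finset (Submodule K (Fin ℓ → K))) (k : ℕ) :
    (charPoly ⊤ A).coeff k = ∑ X ∈ (latticeOf ⊤ A).filter (fun X : Submodule K (Fin ℓ → K) => k = Module.finrank K X),
      mob ⊤ (latticeOf ⊤ A) X := by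
  simp only [charPoly, Polynomial.finsetSum_coeff, Polynomial.coeff_C_mul_X_pow]
  rw [Finset.sum_filter]

lemma bNum_one (hl : 1 ≤ ℓ) {A : Finset (Submodule K (Fin ℓ → K))} (hA : IsArrangement A) :
    bNum A 1 = A.card := by
  rw [bNum, coeff_char]
  have : (latticeOf ⊤ A).filter (fun X : Submodule K (Fin ℓ → K) => ℓ - 1 = Module.finrank K X) = A := by
    ext X
    rw [Finset.mem_filter]
    constructor
    · rintro ⟨h1, h2⟩
      rcases lat_cases h1 with rfl | h | ⟨M, hM, M', hM', hn', h⟩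
      · rw [finrank_top, Module.finrank_fin_fun] at h2; omega
      · exact h
      · have h3 := inf_finrank (hA M hM) (hA M' hM') hn'
        have h4 := Submodule.finrank_mono h
        omega
    · intro h
      have := hyp_finrank (hA X h)
      exact ⟨mem_lat h, by omega⟩
  rw [this, Finset.sum_congr rfl (fun Y hY => mob_hyp hA hY)]
  simp

lemma bNum_two (hl : 2 ≤ ℓ) {A : Finset (Submodule K (Fin ℓ → K))} (hA : IsArrangement A) :
    bNum A 2 = b2 A := by
  rw [bNum, coeff_char]
  have : (latticeOf ⊤ A).filter (fun X : Submodule K (Fin ℓ → K) => ℓ - 2 = Module.finrank K X) = fl A := by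
    ext X
    rw [Finset.mem_filter]
    constructor
    · rintro ⟨h1, h2⟩
      rcases lat_cases h1 with rfl | h | ⟨M, hM, M', hM', hn', h⟩
      · rw [finrank_top, Module.finrank_fin_fun] at h2; omega
      · have := hyp_finrank (hA X h); omega
      · have h3 := inf_finrank (hA M hM) (hA M' hM') hn'
        exact mem_fl.2 ⟨M, hM, M', hM', hn', (Submodule.eq_of_le_of_finrank_eq h (by omega)).symm⟩
    · intro h
      obtain ⟨M, hM, M', hM', hn', rfl⟩ := mem_fl.1 h
      have h3 := inf_finrank (hA M hM) (hA M' hM') hn'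
      exact ⟨fl_mem_lat h, by omega⟩
  rw [this, Finset.sum_congr rfl (fun Y hY => mob_fl hA hY), b2]
  simp

end comb

section asym
variable {K : Type} [Field K] {ℓ : ℕ}

lemma powexp (m : ℕ) : ∃ C : ℝ, ∀ t : ℝ, 0 < t → t < 1 →
    |t ^ m - (1 - m * (1 - t) + m * (m - 1) / 2 * (1 - t) ^ 2)| ≤ C * (1 - t) ^ 3 := by
  induction m with
  | zero => exact ⟨0, fun t _ _ => by simp⟩
  | succ m ih =>
    obtain ⟨C, hC⟩ := ih
    refine ⟨C + |(m : ℝ) * (m - 1) / 2|, fun t h0 h1 => ?_⟩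
    have h := hC t h0 h1
    have e : t ^ (m + 1) - (1 - ((m + 1 : ℕ) : ℝ) * (1 - t) +
        ((m + 1 : ℕ) : ℝ) * (((m + 1 : ℕ) : ℝ) - 1) / 2 * (1 - t) ^ 2) =
        (t ^ m - (1 - m * (1 - t) + m * (m - 1) / 2 * (1 - t) ^ 2)) * t +
          (-((m : ℝ) * (m - 1) / 2)) * (1 - t) ^ 3 := by
      push_cast; ring
    rw [e]
    refine (abs_add_le _ _).trans ?_
    have hu : 0 ≤ (1 - t) ^ 3 := pow_nonneg (by linarith) 3
    rw [abs_mul, abs_mul, abs_neg, abs_of_pos h0, abs_of_nonneg hu, add_mul]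
    have := mul_le_of_le_one_right (abs_nonneg
      (t ^ m - (1 - m * (1 - t) + m * (m - 1) / 2 * (1 - t) ^ 2))) h1.le
    linarith

lemma powexp' (m : ℕ) : ∃ C : ℝ, ∀ t : ℝ, 0 < t → t < 1 →
    |t ^ m * (1 - t) - ((1 - t) - m * (1 - t) ^ 2)| ≤ C * (1 - t) ^ 3 := by
  obtain ⟨C, hC⟩ := powexp m
  obtain ⟨C', hC'⟩ := powexp (m + 1)
  refine ⟨C + C', fun t h0 h1 => ?_⟩
  have h := hC t h0 h1
  have h' := hC' t h0 h1
  have e : t ^ m * (1 - t) - ((1 - t) - m * (1 - t) ^ 2) =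
      (t ^ m - (1 - m * (1 - t) + m * (m - 1) / 2 * (1 - t) ^ 2)) -
      (t ^ (m + 1) - (1 - ((m + 1 : ℕ) : ℝ) * (1 - t) +
        ((m + 1 : ℕ) : ℝ) * (((m + 1 : ℕ) : ℝ) - 1) / 2 * (1 - t) ^ 2)) := by
    push_cast; ring
  rw [e]
  refine (abs_sub _ _).trans ?_
  linarith

lemma est (A : Finset (Submodule K (Fin ℓ → K))) : IsArrangement A → ∃ C : ℝ, ∀ t : ℝ,
    0 < t → t < 1 → |HS (dA A) t - (ℓ - A.card * (1 - t) +
      ((A.card : ℝ) * (A.card - 1) / 2 - (b2 A : ℝ)) * (1 - t) ^ 2) * HS (hS K ℓ) t| ≤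
      C * (1 - t) ^ 3 * HS (hS K ℓ) t := by
  induction A using Finset.induction_on with
  | empty =>
    intro _
    refine ⟨0, fun t h0 h1 => ?_⟩
    have : HS (dA (∅ : Finset (Submodule K (Fin ℓ → K)))) t = ℓ * HS (hS K ℓ) t := by
      unfold HS
      rw [← tsum_mul_left]
      congr 1; funext m
      rw [dA_empty]; push_cast; ring
    rw [this, b2_empty]
    simp
  | insert H A hHA ih =>
    intro hAH
    obtain ⟨C, hC⟩ := ih (fun L hL => hAH L (Finset.mem_insert_of_mem hL))
    obtain ⟨b, r, E, hr, hbr, hst⟩ := step hAH hHA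
    obtain ⟨C', hC'⟩ := powexp' b
    refine ⟨C + C' + |E|, fun t h0 h1 => ?_⟩
    have hp : 0 < HS (hS K ℓ) t := HS_hS_pos h0 h1
    have hu : 0 ≤ (1 - t) ^ 3 := pow_nonneg (by linarith) 3
    have h := abs_le.1 (hC t h0 h1)
    have h' := abs_le.1 (hC' t h0 h1)
    obtain ⟨s1, s2⟩ := hst t h0 h1
    have h'1 := mul_le_mul_of_nonneg_right h'.1 hp.le
    have h'2 := mul_le_mul_of_nonneg_right h'.2 hp.le
    have hE : E * (1 - t) ^ 3 * HS (hS K ℓ) t ≤ |E| * (1 - t) ^ 3 * HS (hS K ℓ) t := by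
      have := le_abs_self E
      gcongr
    have hE0 : 0 ≤ |E| * (1 - t) ^ 3 * HS (hS K ℓ) t := by positivity
    rw [b2_insert hAH hHA, Finset.card_insert_of_notMem hHA, ← hr]
    have hb : (b : ℝ) = A.card - r := by rw [← hbr]; push_cast; ring
    rw [hb] at h'1 h'2
    push_cast
    rw [abs_le]
    constructor
    · linear_combination h.1 + h'2 + s1 + hE0
    · linear_combination h.2 + h'1 + s2 + hE

lemma small {a D : ℝ} (h : ∀ u : ℝ, 0 < u → u < 1 → |a| ≤ D * u) : a = 0 := by
  by_contra ha
  have hp : 0 < |a| := abs_pos.2 ha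
  have h1 := h (1 / 2) (by norm_num) (by norm_num)
  have hD : |a| < D := by linarith
  have hD0 : 0 < D := by linarith
  have h2 := h (|a| / (2 * D)) (by positivity) (by rw [div_lt_one (by positivity)]; linarith)
  have h3 : D * (|a| / (2 * D)) = |a| / 2 := by field_simp
  linarith

lemma quad {a b C : ℝ} (h : ∀ u : ℝ, 0 < u → u < 1 → |a * u + b * u ^ 2| ≤ C * u ^ 3) :
    a = 0 ∧ b = 0 := by
  have ha : a = 0 := by
    refine small (D := |C| + |b|) fun u h0 h1 => ?_
    have h2 : |a + b * u| ≤ C * u ^ 2 := by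
      have := h u h0 h1
      have e : a * u + b * u ^ 2 = (a + b * u) * u := by ring
      rw [e, abs_mul, abs_of_pos h0] at this
      refine le_of_mul_le_mul_right ?_ h0
      linarith
    have h3 : |a| ≤ |a + b * u| + |b * u| := by
      have := abs_sub (a + b * u) (b * u)
      rwa [add_sub_cancel_right] at this
    rw [abs_mul, abs_of_pos h0] at h3
    have h4 : C * u ^ 2 ≤ |C| * u := by
      have : u ^ 2 ≤ u := by nlinarith
      have := le_abs_self C
      calc C * u ^ 2 ≤ |C| * u ^ 2 := by gcongr
        _ ≤ |C| * u := by gcongr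
    linarith
  refine ⟨ha, small (D := C) fun u h0 h1 => ?_⟩
  have := h u h0 h1
  rw [ha, zero_mul, zero_add, abs_mul, abs_of_pos (pow_pos h0 2)] at this
  refine le_of_mul_le_mul_right ?_ (pow_pos h0 2)
  linarith

lemma sumexp (s : Finset (Fin ℓ)) (e : Fin ℓ → ℕ) : ∃ C : ℝ, ∀ t : ℝ, 0 < t → t < 1 →
    |∑ i ∈ s, t ^ e i - (s.card - (∑ i ∈ s, (e i : ℝ)) * (1 - t) +
      (∑ i ∈ s, (e i : ℝ) * (e i - 1) / 2) * (1 - t) ^ 2)| ≤ C * (1 - t) ^ 3 := by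
  choose C hC using powexp
  refine ⟨∑ i ∈ s, C (e i), fun t h0 h1 => ?_⟩
  have : ∑ i ∈ s, t ^ e i - (s.card - (∑ i ∈ s, (e i : ℝ)) * (1 - t) +
      (∑ i ∈ s, (e i : ℝ) * (e i - 1) / 2) * (1 - t) ^ 2) =
      ∑ i ∈ s, (t ^ e i - (1 - e i * (1 - t) + e i * (e i - 1) / 2 * (1 - t) ^ 2)) := by
    rw [Finset.sum_sub_distrib, Finset.sum_add_distrib, Finset.sum_sub_distrib, Finset.sum_mul,
      Finset.sum_mul]
    simp
  rw [this, Finset.sum_mul]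
  exact (Finset.abs_sum_le_sum_abs _ _).trans (Finset.sum_le_sum fun i _ => hC _ t h0 h1)

lemma main_coeffs {A : Finset (Submodule K (Fin ℓ → K))} (hA : IsArrangement A)
    {e : Fin ℓ → ℕ} {lev : ℕ} (hpog : IsPOG A e lev) :
    (A.card : ℝ) + 1 = ∑ i, (e i : ℝ) ∧
    ∑ i, (e i : ℝ) * (e i - 1) / 2 - lev = (A.card : ℝ) * (A.card - 1) / 2 - (b2 A : ℝ) := by
  obtain ⟨C1, h1⟩ := est A hA
  obtain ⟨C2, h2⟩ := sumexp Finset.univ e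
  obtain ⟨C3, h3⟩ := powexp' lev
  have := quad (a := (A.card : ℝ) + 1 - ∑ i, (e i : ℝ))
    (b := ∑ i, (e i : ℝ) * (e i - 1) / 2 - lev - ((A.card : ℝ) * (A.card - 1) / 2 - (b2 A : ℝ)))
    (C := C1 + C2 + C3) (fun u u0 u1 => by
      have hp : 0 < HS (hS K ℓ) (1 - u) := HS_hS_pos (by linarith) (by linarith)
      have g1 := h1 (1 - u) (by linarith) (by linarith)
      have g2 := abs_le.1 (h2 (1 - u) (by linarith) (by linarith))
      have g3 := abs_le.1 (h3 (1 - u) (by linarith) (by linarith))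
      rw [pog_HS hpog (by linarith) (by linarith), ← sub_mul, abs_mul, abs_of_pos hp] at g1
      have g1 := abs_le.1 (le_of_mul_le_mul_right g1 hp)
      simp only [sub_sub_cancel, Finset.card_univ, Fintype.card_fin] at g1 g2 g3
      rw [abs_le]
      constructor
      · linear_combination g1.1 + g2.2 + g3.2
      · linear_combination g1.2 + g2.1 + g3.1)
  constructor
  · linarith [this.1]
  · linarith [this.2]

lemma sq_sum (s : Finset (Fin ℓ)) (x : Fin ℓ → ℤ) :
    (∑ i ∈ s, x i) ^ 2 = ∑ i ∈ s, x i ^ 2 +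
      2 * ∑ i ∈ s, ∑ j ∈ s.filter (fun j => i < j), x i * x j := by
  have h1 : ∑ i ∈ s, ∑ j ∈ s.filter (fun j => i < j), x i * x j =
      ∑ i ∈ s, ∑ j ∈ s, (if i < j then x i * x j else 0) :=
    Finset.sum_congr rfl fun i _ => by rw [Finset.sum_filter]
  have h2 : ∑ i ∈ s, ∑ j ∈ s, (if i < j then x i * x j else 0) =
      ∑ i ∈ s, ∑ j ∈ s, (if j < i then x i * x j else 0) := by
    rw [Finset.sum_comm]
    refine Finset.sum_congr rfl fun i _ => Finset.sum_congr rfl fun j _ => ?_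
    rw [mul_comm]
  have h3 : ∑ i ∈ s, x i ^ 2 = ∑ i ∈ s, ∑ j ∈ s, (if i = j then x i * x j else 0) := by
    refine Finset.sum_congr rfl fun i hi => ?_
    rw [Finset.sum_ite_eq, if_pos hi, sq]
  rw [h3, two_mul]
  nth_rw 2 [h1]
  rw [h1, h2, ← h2]
  nth_rw 2 [h2]
  rw [sq, Finset.sum_mul_sum, ← Finset.sum_add_distrib, ← Finset.sum_add_distrib]
  refine Finset.sum_congr rfl fun i _ => ?_
  rw [← Finset.sum_add_distrib, ← Finset.sum_add_distrib]
  refine Finset.sum_congr rfl fun j _ => ?_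
  rcases lt_trichotomy i j with h | h | h
  · simp [h, h.ne, h.not_gt]
  · simp [h]
  · simp [h, h.ne', h.not_gt]

end asym

/-- Proposition `Betti`: if `A` is plus-one generated with
`POexp(A) = (d₁,…,d_ℓ)` (`d₁ = 1`) and level `d`, then `b₁(A) = |A| = Σ_{i=2}^ℓ dᵢ`
and `b₂(A) = Σ_{2 ≤ i < j ≤ ℓ} dᵢ dⱼ + d`. -/
theorem POG_betti_numbers {K : Type} [Field K] {ℓ : ℕ} (hl : 1 ≤ ℓ)
    (A : Finset (Submodule K (Fin ℓ → K)))
    (hA : IsArrangement A) (hEss : Essential A)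
    (e : Fin ℓ → ℕ) (lev : ℕ) (hpog : IsPOG A e lev)
    (he0 : e ⟨0, by omega⟩ = 1) :
    bNum A 1 = (A.card : ℤ) ∧
    (A.card : ℤ) = ∑ i ∈ Finset.univ.filter (fun i : Fin ℓ => 1 ≤ i.val), (e i : ℤ) ∧
    bNum A 2 = (∑ i ∈ Finset.univ.filter (fun i : Fin ℓ => 1 ≤ i.val),
        ∑ j ∈ Finset.univ.filter (fun j : Fin ℓ => i < j), (e i : ℤ) * (e j : ℤ)) + lev := by
  obtain ⟨h1, h2⟩ := main_coeffs hA hpog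
  set s := Finset.univ.filter (fun i : Fin ℓ => 1 ≤ i.val) with hs
  have hu : (Finset.univ : Finset (Fin ℓ)) = insert ⟨0, by omega⟩ s := by
    ext i
    simp only [hs, Finset.mem_univ, Finset.mem_insert, Finset.mem_filter, true_and, true_iff,
      Fin.ext_iff]
    omega
  have h0s : (⟨0, by omega⟩ : Fin ℓ) ∉ s := by simp [hs]
  rw [hu, Finset.sum_insert h0s, he0] at h1 h2
  have k1 : (A.card : ℤ) = ∑ i ∈ s, (e i : ℤ) := by
    have : (A.card : ℝ) = ∑ i ∈ s, (e i : ℝ) := by push_cast at h1; linarith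
    exact_mod_cast this
  have hl2 : 2 ≤ ℓ := by
    by_contra hlt
    have hl1 : ℓ = 1 := by omega
    subst hl1
    have : s = ∅ := by
      rw [hs, Finset.filter_eq_empty_iff]
      intro i _
      omega
    rw [this, Finset.sum_empty] at k1
    have hA0 : A = ∅ := Finset.card_eq_zero.1 (by exact_mod_cast k1)
    rw [hA0, Essential, Finset.inf_empty] at hEss
    exact top_ne_bot hEss
  refine ⟨bNum_one hl hA, k1, ?_⟩
  rw [bNum_two hl2 hA]
  have hfil : ∑ i ∈ s, ∑ j ∈ Finset.univ.filter (fun j : Fin ℓ => i < j), (e i : ℤ) * (e j : ℤ) =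
      ∑ i ∈ s, ∑ j ∈ s.filter (fun j => i < j), (e i : ℤ) * (e j : ℤ) := by
    refine Finset.sum_congr rfl fun i _ => Finset.sum_congr ?_ fun _ _ => rfl
    ext j
    simp only [hs, Finset.mem_filter, Finset.mem_univ, true_and, Fin.lt_def]
    omega
  have hsq := sq_sum s (fun i => (e i : ℤ))
  rw [← k1] at hsq
  rw [hfil]
  have k2 : ∑ i ∈ s, (e i : ℤ) ^ 2 - A.card - 2 * lev = (A.card : ℤ) * (A.card - 1) - 2 * b2 A := by
    have e1 : ∑ i ∈ s, (e i : ℝ) * (e i - 1) / 2 =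
        (∑ i ∈ s, (e i : ℝ) ^ 2 - ∑ i ∈ s, (e i : ℝ)) / 2 := by
      rw [← Finset.sum_sub_distrib, Finset.sum_div]
      exact Finset.sum_congr rfl fun i _ => by ring
    have e2 : (A.card : ℝ) = ∑ i ∈ s, (e i : ℝ) := by exact_mod_cast k1
    rw [e1, ← e2] at h2
    have : ∑ i ∈ s, (e i : ℝ) ^ 2 - A.card - 2 * lev =
        (A.card : ℝ) * (A.card - 1) - 2 * (b2 A : ℝ) := by
      push_cast at h2; linarith
    exact_mod_cast this
  linarith

end ArrPOG
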